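/- arXiv:2301.08726 — 3 statements merged into one kernel-verified Lean document; each statement's English description precedes it below -/
import Mathlib

section
/- Let r : [0,∞) → ℝ be real, positive and twice continuously differentiable, and set φ(t) = (4r(t)r''(t) − 5r'(t)²)/(16 r(t)^{5/2}). Then for every T > 0, the differential equation z̈(t) − r(t)z(t) = 0 on [0,T] has two real twice continuously differentiable solutions z1(t) = ((1+δ1(t))/r(t)^{1/4}) exp(∫₀ᵗ √(r(s)) ds) and z2(t) = ((1+δ2(t))/r(t)^{1/4}) exp(−∫₀ᵗ √(r(s)) ds), where |δ1(t)| ≤ exp((1/2)∫₀ᵗ |φ(s)| ds) − 1 and |δ2(t)| ≤ exp((1/2)∫ₜ^T |φ(s)| ds) − 1 for all t ∈ [0,T]. If moreover ∫₀^∞ |φ(s)| ds < ∞, the same conclusion holds with T = +∞. -/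
open Real Filter MeasureTheory Set

/-- The Liouville--Green approximate solution with correction term `δ`:
`t ↦ ((1 + δ t)/r t ^ (1/4)) * exp (sign * ∫₀ᵗ √(r s) ds)`. -/
noncomputable def LGsol (r δ : ℝ → ℝ) (sign : ℝ) : ℝ → ℝ := fun t =>
  (1 + δ t) / r t ^ ((1:ℝ)/4) * Real.exp (sign * ∫ s in (0:ℝ)..t, Real.sqrt (r s))

/-- The terms of the Picard series for the linear equation `x' = A t x`, `x 0 = x₀`. -/
noncomputable def picardTerm {E : Type*} [NormedAddCommGroup E] [NormedSpace ℝ E]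
    (A : ℝ → E →L[ℝ] E) (x₀ : E) : ℕ → ℝ → E
  | 0 => fun _ => x₀
  | n + 1 => fun t => ∫ s in (0:ℝ)..t, A s (picardTerm A x₀ n s)

section PicardSeries

variable {E : Type*} [NormedAddCommGroup E] [NormedSpace ℝ E] {A : ℝ → E →L[ℝ] E}

theorem continuous_picardTerm (hA : Continuous A) (x₀ : E) (n : ℕ) :
    Continuous (picardTerm A x₀ n) := by
  induction n with
  | zero => exact continuous_const
  | succ n ih =>
    exact intervalIntegral.continuous_primitive
      (fun a b => (hA.clm_apply ih).intervalIntegrable a b) 0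

theorem hasDerivAt_picardTerm_succ [CompleteSpace E] (hA : Continuous A) (x₀ : E) (n : ℕ)
    (t : ℝ) : HasDerivAt (picardTerm A x₀ (n + 1)) (A t (picardTerm A x₀ n t)) t :=
  (hA.clm_apply (continuous_picardTerm hA x₀ n)).integral_hasStrictDerivAt 0 t |>.hasDerivAt

theorem norm_picardTerm_le (x₀ : E) {R M : ℝ} (hM : 0 ≤ M)
    (hAM : ∀ t, |t| ≤ R → ‖A t‖ ≤ M) (n : ℕ) {t : ℝ} (ht : |t| ≤ R) :
    ‖picardTerm A x₀ n t‖ ≤ ‖x₀‖ * ((M * |t|) ^ n / n.factorial) := by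
  induction n generalizing t with
  | zero => simp [picardTerm]
  | succ n ih =>
    have hI : IntegrableOn (fun s : ℝ => ‖x₀‖ * M ^ (n + 1) / n.factorial * |s - 0| ^ n)
        (uIoc 0 t) := by
      rw [← intervalIntegrable_iff]
      exact (by fun_prop : Continuous _).intervalIntegrable _ _
    calc ‖picardTerm A x₀ (n + 1) t‖
        = ‖∫ s in uIoc 0 t, A s (picardTerm A x₀ n s)‖ :=
          intervalIntegral.norm_integral_eq_norm_integral_uIoc _
      _ ≤ ∫ s in uIoc 0 t, ‖x₀‖ * M ^ (n + 1) / n.factorial * |s - 0| ^ n := by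
          refine MeasureTheory.norm_integral_le_of_norm_le hI ?_
          refine (ae_restrict_iff' measurableSet_uIoc).2 (Eventually.of_forall fun s hs => ?_)
          have hs' : |s| ≤ R := by
            refine le_trans ?_ ht
            have := abs_sub_left_of_mem_uIcc (uIoc_subset_uIcc hs)
            simpa using this
          calc ‖A s (picardTerm A x₀ n s)‖ ≤ ‖A s‖ * ‖picardTerm A x₀ n s‖ :=
                (A s).le_opNorm _
            _ ≤ M * (‖x₀‖ * ((M * |s|) ^ n / n.factorial)) := by
                gcongr
                · exact hAM s hs'
                · exact ih hs'
            _ = ‖x₀‖ * M ^ (n + 1) / n.factorial * |s - 0| ^ n := by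
                rw [sub_zero]; ring
      _ = ‖x₀‖ * ((M * |t|) ^ (n + 1) / (n + 1).factorial) := by
          rw [integral_const_mul, integral_pow_abs_sub_uIoc, Nat.factorial_succ, sub_zero]
          push_cast
          rw [mul_pow]
          field_simp

/-- A linear differential equation with continuous coefficients on the whole line has a solution
on the whole line for every initial value. -/
theorem exists_hasDerivAt_linear [CompleteSpace E] (hA : Continuous A) (x₀ : E) :
    ∃ x : ℝ → E, x 0 = x₀ ∧ ∀ t, HasDerivAt x (A t (x t)) t := by
  have zero_at : ∀ n, picardTerm A x₀ (n + 1) 0 = 0 := fun n => by simp [picardTerm]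
  refine ⟨fun t => ∑' n, picardTerm A x₀ n t, ?_, fun t => ?_⟩
  · simp only
    rw [tsum_eq_single 0 fun n hn => ?_]
    · rfl
    · obtain ⟨m, rfl⟩ := Nat.exists_eq_succ_of_ne_zero hn
      exact zero_at m
  obtain ⟨R, hR0, htR⟩ : ∃ R : ℝ, 0 < R ∧ |t| < R := ⟨|t| + 1, by positivity, by linarith⟩
  obtain ⟨M, hM⟩ := (isCompact_Icc (a := -R) (b := R)).exists_bound_of_continuousOn hA.continuousOn
  have hAM : ∀ s, |s| ≤ R → ‖A s‖ ≤ M := fun s hs => hM s (abs_le.1 hs)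
  have hM0 : 0 ≤ M := (norm_nonneg _).trans (hAM 0 (by simpa using hR0.le))
  have hbound : ∀ n s, |s| ≤ R →
      ‖picardTerm A x₀ n s‖ ≤ ‖x₀‖ * ((M * R) ^ n / n.factorial) := fun n s hs =>
    (norm_picardTerm_le x₀ hM0 hAM n hs).trans (by gcongr)
  have hsum : Summable fun n : ℕ => ‖x₀‖ * ((M * R) ^ n / n.factorial) :=
    (Real.summable_pow_div_factorial _).mul_left _
  have hsumt : ∀ s, |s| ≤ R → Summable fun n => picardTerm A x₀ n s := fun s hs =>
    Summable.of_norm_bounded hsum fun n => hbound n s hs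
  have hd : HasDerivAt (fun s => ∑' n, picardTerm A x₀ (n + 1) s)
      (∑' n, A t (picardTerm A x₀ n t)) t := by
    refine hasDerivAt_tsum_of_isPreconnected (hsum.mul_left M) isOpen_Ioo
      (isPreconnected_Ioo (a := -R) (b := R))
      (fun n s _ => hasDerivAt_picardTerm_succ hA x₀ n s) (fun n s hs => ?_)
      (abs_lt.1 htR) ((summable_nat_add_iff 1).2 (hsumt t htR.le)) (abs_lt.1 htR)
    have hs' : |s| ≤ R := (abs_lt.2 hs).le
    exact ((A s).le_opNorm _).trans
      (mul_le_mul (hAM s hs') (hbound n s hs') (norm_nonneg _) hM0)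
  rw [← (A t).map_tsum (hsumt t htR.le)] at hd
  refine (hd.const_add x₀).congr_of_eventuallyEq ?_
  filter_upwards [isOpen_Ioo.mem_nhds (abs_lt.1 htR)] with s hs
  exact (hsumt s (abs_lt.2 hs).le).tsum_eq_zero_add

end PicardSeries

/-- The initial value problem at `0` for `z'' = q z` with `q` continuous has a global solution. -/
theorem exists_solution_second_order {q : ℝ → ℝ} (hq : Continuous q) (a b : ℝ) :
    ∃ z z₁ : ℝ → ℝ, z 0 = a ∧ z₁ 0 = b ∧
      ∀ t, HasDerivAt z (z₁ t) t ∧ HasDerivAt z₁ (q t * z t) t := by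
  have hA : Continuous fun t => (ContinuousLinearMap.snd ℝ ℝ ℝ).prod
      (q t • ContinuousLinearMap.fst ℝ ℝ ℝ) :=
    (ContinuousLinearMap.prodₗᵢ ℝ : ((ℝ × ℝ →L[ℝ] ℝ) × (ℝ × ℝ →L[ℝ] ℝ)) ≃ₗᵢ[ℝ] _).continuous.comp
      (continuous_const.prodMk (hq.smul continuous_const))
  obtain ⟨x, hx0, hx⟩ := exists_hasDerivAt_linear hA (a, b)
  refine ⟨fun t => (x t).1, fun t => (x t).2, by simp [hx0], by simp [hx0], fun t => ⟨?_, ?_⟩⟩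
  · exact (hx t).fst
  · exact (hx t).snd

theorem ContinuousOn.hasDerivAt_integral {f : ℝ → ℝ} {T t : ℝ} (hf : ContinuousOn f (Icc 0 T))
    (ht : t ∈ Ioo 0 T) : HasDerivAt (fun u => ∫ s in (0:ℝ)..u, f s) (f t) t :=
  intervalIntegral.integral_hasDerivAt_right
    ((hf.mono (Icc_subset_Icc_right ht.2.le)).intervalIntegrable_of_Icc ht.1.le)
    ((hf.mono Ioo_subset_Icc_self).stronglyMeasurableAtFilter isOpen_Ioo t ht)
    (hf.continuousAt (Icc_mem_nhds ht.1 ht.2))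

/-- A form of Grönwall's inequality, with the weight `a` integrated. -/
theorem integral_mul_abs_le_exp {a h : ℝ → ℝ} {T : ℝ}
    (ha : ContinuousOn a (Icc 0 T)) (hh : ContinuousOn h (Icc 0 T))
    (ha0 : ∀ t ∈ Icc 0 T, 0 ≤ a t)
    (hle : ∀ t ∈ Icc 0 T, |h t - 1| ≤ ∫ s in (0:ℝ)..t, a s * |h s|) :
    ∀ t ∈ Icc 0 T, ∫ s in (0:ℝ)..t, a s * |h s| ≤ exp (∫ s in (0:ℝ)..t, a s) - 1 := by
  intro t ht
  have hT : 0 ≤ T := ht.1.trans ht.2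
  have hah : ContinuousOn (fun s => a s * |h s|) (Icc 0 T) := ha.mul hh.abs
  set m : ℝ → ℝ := fun t => ∫ s in (0:ℝ)..t, a s * |h s| with hm
  set I : ℝ → ℝ := fun t => ∫ s in (0:ℝ)..t, a s with hI
  have hprim : ∀ f : ℝ → ℝ, ContinuousOn f (Icc 0 T) →
      ContinuousOn (fun t => ∫ s in (0:ℝ)..t, f s) (Icc 0 T) := fun f hf => by
    have := intervalIntegral.continuousOn_primitive_interval (a := 0) (b := T) (f := f)
      (μ := volume) (by rw [uIcc_of_le hT]; exact hf.integrableOn_Icc)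
    rwa [uIcc_of_le hT] at this
  have hd : ∀ s ∈ Ioo 0 T, HasDerivAt (fun s => (1 + m s) * exp (-I s))
      (a s * |h s| * exp (-I s) + (1 + m s) * (exp (-I s) * -a s)) s := fun s hs =>
    ((hah.hasDerivAt_integral hs).const_add 1).mul (ha.hasDerivAt_integral hs).neg.exp
  have hanti : AntitoneOn (fun s => (1 + m s) * exp (-I s)) (Icc 0 T) := by
    refine antitoneOn_of_deriv_nonpos (convex_Icc 0 T) ?_ ?_ ?_
    · exact ((hprim _ hah).const_add 1).mul (hprim _ ha).neg.rexp
    · rw [interior_Icc]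
      exact fun s hs => (hd s hs).differentiableAt.differentiableWithinAt
    · rw [interior_Icc]
      intro s hs
      rw [(hd s hs).deriv]
      have hs' := Ioo_subset_Icc_self hs
      have h1 : |h s| ≤ 1 + m s := by
        have := abs_sub_abs_le_abs_sub (h s) 1
        rw [abs_one] at this
        linarith [hle s hs']
      have h2 := mul_nonneg (mul_nonneg (ha0 s hs') (sub_nonneg.2 h1)) (exp_pos (-I s)).le
      linarith
  have h0 := hanti (left_mem_Icc.2 hT) ht ht.1
  simp only [hm, hI, intervalIntegral.integral_same, neg_zero, exp_zero, add_zero, mul_one,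
    exp_neg, ← div_eq_mul_inv] at h0
  rw [div_le_one (exp_pos _)] at h0
  linarith

/-- Error bound for the Liouville-Green approximation `z ≈ g⁻¹ exp S`, where `S' = g ^ 2`, of the
solution of `z'' = g ^ 4 z` that agrees with the approximation to first order at `0`; the second
bound controls the derivative of the relative error. -/
theorem liouvilleGreen_error_bound {g g₁ φ S z z₁ : ℝ → ℝ} {T : ℝ}
    (hg : ∀ t ∈ Icc 0 T, 0 < g t) (hdg : ∀ t ∈ Icc 0 T, HasDerivAt g (g₁ t) t)
    (hdg₁ : ∀ t ∈ Icc 0 T, HasDerivAt g₁ (φ t * g t ^ 3 + 2 * g₁ t ^ 2 / g t) t)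
    (hdS : ∀ t ∈ Icc 0 T, HasDerivAt S (g t ^ 2) t) (hφ : ContinuousOn φ (Icc 0 T))
    (hdz : ∀ t ∈ Icc 0 T, HasDerivAt z (z₁ t) t)
    (hdz₁ : ∀ t ∈ Icc 0 T, HasDerivAt z₁ (g t ^ 4 * z t) t)
    (hS0 : S 0 = 0) (hz0 : z 0 * g 0 = 1) (hz₁0 : z₁ 0 * g 0 + z 0 * g₁ 0 - z 0 * g 0 ^ 3 = 0) :
    ∀ t ∈ Icc 0 T,
      |z t * g t * exp (-S t) - 1| ≤ exp (1 / 2 * ∫ s in (0:ℝ)..t, |φ s|) - 1 ∧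
      |(z₁ t * g t + z t * g₁ t - z t * g t ^ 3) / g t ^ 2 * exp (-S t)| ≤
        2 * (exp (1 / 2 * ∫ s in (0:ℝ)..t, |φ s|) - 1) := by
  set h : ℝ → ℝ := fun t => z t * g t * exp (-S t) with hh
  set p : ℝ → ℝ := fun t => (z₁ t * g t + z t * g₁ t - z t * g t ^ 3) / g t ^ 2 * exp (-S t)
    with hp
  have hdh : ∀ t ∈ Icc 0 T, HasDerivAt h (g t ^ 2 * p t) t := fun t ht => by
    have hgt := (hg t ht).ne'
    convert! ((hdz t ht).mul (hdg t ht)).mul (hdS t ht).neg.exp using 1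
    simp only [hp, Pi.mul_apply, Pi.neg_apply]
    field_simp
    ring
  have hdp : ∀ t ∈ Icc 0 T, HasDerivAt p (φ t * h t - 2 * g t ^ 2 * p t) t := fun t ht => by
    have hgt := (hg t ht).ne'
    convert! (((((hdz₁ t ht).mul (hdg t ht)).add ((hdz t ht).mul (hdg₁ t ht))).sub
      ((hdz t ht).mul ((hdg t ht).pow 3))).div ((hdg t ht).pow 2) (pow_ne_zero 2 hgt)).mul
      (hdS t ht).neg.exp using 1
    simp only [hp, hh, Pi.mul_apply, Pi.add_apply, Pi.sub_apply, Pi.div_apply, Pi.pow_apply,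
      Pi.neg_apply]
    field_simp
    ring
  have hch : ContinuousOn h (Icc 0 T) := HasDerivAt.continuousOn hdh
  have hcS : ContinuousOn S (Icc 0 T) := HasDerivAt.continuousOn hdS
  have hp0 : p 0 = 0 := by simp [hp, hz₁0]
  have hh0 : h 0 = 1 := by simp [hh, hz0, hS0]
  have hmono : MonotoneOn S (Icc 0 T) := by
    refine monotoneOn_of_deriv_nonneg (convex_Icc 0 T) hcS
      (fun s hs => (hdS s (interior_subset hs)).differentiableAt.differentiableWithinAt)
      fun s hs => ?_
    rw [(hdS s (interior_subset hs)).deriv]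
    positivity
  have h_int : ∀ t ∈ Icc 0 T, ∀ f : ℝ → ℝ, ContinuousOn f (Icc 0 T) →
      IntervalIntegrable f volume 0 t := fun t ht f hf =>
    (hf.mono (Icc_subset_Icc_right ht.2)).intervalIntegrable_of_Icc ht.1
  have hFTC : ∀ t ∈ Icc 0 T, ∀ f f' : ℝ → ℝ, (∀ s ∈ Icc 0 T, HasDerivAt f (f' s) s) →
      ContinuousOn f' (Icc 0 T) → ∫ s in (0:ℝ)..t, f' s = f t - f 0 := fun t ht f f' hd hc => by
    refine intervalIntegral.integral_eq_sub_of_hasDerivAt (fun s hs => hd s ?_) (h_int t ht f' hc)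
    rw [uIcc_of_le ht.1] at hs
    exact ⟨hs.1, hs.2.trans ht.2⟩
  have hcE : ContinuousOn (fun s => exp (2 * S s)) (Icc 0 T) := (hcS.const_mul 2).rexp
  have hcφh : ContinuousOn (fun s => φ s * h s) (Icc 0 T) := hφ.mul hch
  have hpt : ∀ t ∈ Icc 0 T, p t = ∫ s in (0:ℝ)..t, exp (2 * S s - 2 * S t) * (φ s * h s) := by
    intro t ht
    have h1 := hFTC t ht (fun s => p s * exp (2 * S s)) (fun s => exp (2 * S s) * (φ s * h s))
      (fun s hs => by
        convert! (hdp s hs).mul ((hdS s hs).const_mul 2).exp using 1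
        ring) (hcE.mul hcφh)
    simp only [hp0, zero_mul, sub_zero] at h1
    simp only [exp_sub, div_mul_eq_mul_div, intervalIntegral.integral_div, h1]
    field_simp
  have hht : ∀ t ∈ Icc 0 T,
      h t - 1 = ∫ s in (0:ℝ)..t, 1 / 2 * (1 - exp (2 * S s - 2 * S t)) * (φ s * h s) := by
    intro t ht
    have h1 := hFTC t ht (fun s => h s + 1 / 2 * p s) (fun s => 1 / 2 * (φ s * h s))
      (fun s hs => by
        convert! (hdh s hs).add ((hdp s hs).const_mul (1 / 2)) using 1
        ring) (hcφh.const_mul _)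
    simp only [hp0, hh0, mul_zero, add_zero] at h1
    have h2 : ∫ s in (0:ℝ)..t, 1 / 2 * (1 - exp (2 * S s - 2 * S t)) * (φ s * h s) =
        (∫ s in (0:ℝ)..t, 1 / 2 * (φ s * h s)) -
          1 / 2 * ∫ s in (0:ℝ)..t, exp (2 * S s - 2 * S t) * (φ s * h s) := by
      have hc : ContinuousOn (fun s => 1 / 2 * (exp (2 * S s - 2 * S t) * (φ s * h s))) (Icc 0 T) :=
        (((hcS.const_mul 2).sub continuousOn_const).rexp.mul hcφh).const_mul _
      rw [← intervalIntegral.integral_const_mul, ← intervalIntegral.integral_sub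
        (h_int t ht _ (hcφh.const_mul _)) (h_int t ht _ hc)]
      exact intervalIntegral.integral_congr fun s _ => by ring
    rw [h2, h1, ← hpt t ht]
    ring
  have hexp : ∀ t ∈ Icc 0 T, ∀ s ∈ Ioc 0 t, exp (2 * S s - 2 * S t) ≤ 1 := fun t ht s hs => by
    have := hmono ⟨hs.1.le, hs.2.trans ht.2⟩ ht hs.2
    exact exp_le_one_iff.2 (by linarith)
  have hcm : ContinuousOn (fun s => 1 / 2 * |φ s| * |h s|) (Icc 0 T) :=
    (hφ.abs.const_mul _).mul hch.abs
  have hle : ∀ t ∈ Icc 0 T, |h t - 1| ≤ ∫ s in (0:ℝ)..t, 1 / 2 * |φ s| * |h s| := by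
    intro t ht
    rw [hht t ht, ← norm_eq_abs]
    refine intervalIntegral.norm_integral_le_of_norm_le ht.1
      (Eventually.of_forall fun s hs => ?_) (h_int t ht _ hcm)
    have h1 := hexp t ht s hs
    have h2 := exp_pos (2 * S s - 2 * S t)
    rw [norm_eq_abs, abs_mul, abs_mul (φ s), abs_of_nonneg (by linarith), mul_assoc (1 / 2) |φ s|]
    gcongr
    linarith
  have hplet : ∀ t ∈ Icc 0 T, |p t| ≤ 2 * ∫ s in (0:ℝ)..t, 1 / 2 * |φ s| * |h s| := by
    intro t ht
    rw [hpt t ht, ← norm_eq_abs, ← intervalIntegral.integral_const_mul]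
    refine intervalIntegral.norm_integral_le_of_norm_le ht.1
      (Eventually.of_forall fun s hs => ?_) (h_int t ht _ (hcm.const_mul _))
    have h1 := hexp t ht s hs
    rw [norm_eq_abs, abs_mul, abs_mul (φ s), abs_of_pos (exp_pos _)]
    nlinarith [mul_nonneg (abs_nonneg (φ s)) (abs_nonneg (h s))]
  intro t ht
  have hgr := integral_mul_abs_le_exp (hφ.abs.const_mul (1 / 2)) hch
    (fun s _ => by positivity) hle t ht
  rw [intervalIntegral.integral_const_mul] at hgr
  exact ⟨(hle t ht).trans hgr, (hplet t ht).trans (by linarith)⟩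

/-- The reflected form of `liouvilleGreen_error_bound`, for the approximation `z ≈ g⁻¹ exp (-S)`
that is exact to first order at the right endpoint. -/
theorem liouvilleGreen_error_bound_right {g g₁ φ S z z₁ : ℝ → ℝ} {T : ℝ}
    (hg : ∀ t ∈ Icc 0 T, 0 < g t) (hdg : ∀ t ∈ Icc 0 T, HasDerivAt g (g₁ t) t)
    (hdg₁ : ∀ t ∈ Icc 0 T, HasDerivAt g₁ (φ t * g t ^ 3 + 2 * g₁ t ^ 2 / g t) t)
    (hdS : ∀ t ∈ Icc 0 T, HasDerivAt S (g t ^ 2) t) (hφ : ContinuousOn φ (Icc 0 T))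
    (hdz : ∀ t ∈ Icc 0 T, HasDerivAt z (z₁ t) t)
    (hdz₁ : ∀ t ∈ Icc 0 T, HasDerivAt z₁ (g t ^ 4 * z t) t)
    (hzT : z T * g T * exp (S T) = 1) (hz₁T : z₁ T * g T + z T * g₁ T + z T * g T ^ 3 = 0) :
    ∀ t ∈ Icc 0 T,
      |z t * g t * exp (S t) - 1| ≤ exp (1 / 2 * ∫ s in t..T, |φ s|) - 1 ∧
      |(z₁ t * g t + z t * g₁ t + z t * g t ^ 3) / g t ^ 2 * exp (S t)| ≤
        2 * (exp (1 / 2 * ∫ s in t..T, |φ s|) - 1) := by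
  have hmem : ∀ {t}, t ∈ Icc 0 T → T - t ∈ Icc 0 T := fun ht =>
    ⟨sub_nonneg.2 ht.2, sub_le_self _ ht.1⟩
  have hrefl : ∀ {f : ℝ → ℝ} {f' t : ℝ}, HasDerivAt f f' (T - t) →
      HasDerivAt (fun s => f (T - s)) (-f') t := fun {f f' t} hf => by
    simpa using hf.comp_const_sub T t
  intro t ht
  have key := liouvilleGreen_error_bound (T := T) (g := fun s => g (T - s))
    (g₁ := fun s => -g₁ (T - s)) (φ := fun s => φ (T - s)) (S := fun s => S T - S (T - s))
    (z := fun s => z (T - s) * exp (S T)) (z₁ := fun s => -z₁ (T - s) * exp (S T))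
    (fun s hs => hg _ (hmem hs)) (fun s hs => hrefl (hdg _ (hmem hs)))
    (fun s hs => by convert! (hrefl (hdg₁ _ (hmem hs))).neg using 1; ring)
    (fun s hs => by convert! (hrefl (hdS _ (hmem hs))).const_sub (S T) using 1; ring)
    (hφ.comp (by fun_prop) fun s hs => hmem hs)
    (fun s hs => (hrefl (hdz _ (hmem hs))).mul_const _)
    (fun s hs => by convert! ((hrefl (hdz₁ _ (hmem hs))).neg).mul_const (exp (S T)) using 1; ring)
    (by simp) (by simp only [sub_zero]; linarith)
    (by simp only [sub_zero]; linear_combination (-exp (S T)) * hz₁T) (T - t) (hmem ht)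
  have hE : exp (S T) * exp (-(S T - S t)) = exp (S t) := by
    rw [← exp_add]; congr 1; ring
  simp only [sub_sub_cancel, intervalIntegral.integral_comp_sub_left (fun s => |φ s|), sub_zero]
    at key
  refine ⟨?_, ?_⟩
  · convert key.1 using 3
    linear_combination (-z t * g t) * hE
  · convert key.2 using 1
    rw [← abs_neg]
    congr 1
    linear_combination ((z₁ t * g t + z t * g₁ t + z t * g t ^ 3) / g t ^ 2) * hE

section SecondOrder

variable {q : ℝ → ℝ}

theorem exists_solution_second_order_at (hq : Continuous q) (t₀ a b : ℝ) :
    ∃ z z₁ : ℝ → ℝ, z t₀ = a ∧ z₁ t₀ = b ∧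
      ∀ t, HasDerivAt z (z₁ t) t ∧ HasDerivAt z₁ (q t * z t) t := by
  obtain ⟨z, z₁, h0, h1, h⟩ :=
    exists_solution_second_order (hq.comp (continuous_add_const t₀)) a b
  refine ⟨fun t => z (t - t₀), fun t => z₁ (t - t₀), by simpa, by simpa, fun t => ⟨?_, ?_⟩⟩
  · exact (h (t - t₀)).1.comp_sub_const t t₀
  · simpa using (h (t - t₀)).2.comp_sub_const t t₀

theorem wronskian_eq {y y₁ z z₁ : ℝ → ℝ}
    (hy : ∀ t, HasDerivAt y (y₁ t) t ∧ HasDerivAt y₁ (q t * y t) t)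
    (hz : ∀ t, HasDerivAt z (z₁ t) t ∧ HasDerivAt z₁ (q t * z t) t) (s t : ℝ) :
    y s * z₁ s - y₁ s * z s = y t * z₁ t - y₁ t * z t := by
  have hd : ∀ t, HasDerivAt (fun t => y t * z₁ t - y₁ t * z t) 0 t := fun t => by
    convert! ((hy t).1.mul (hz t).2).sub ((hy t).2.mul (hz t).1) using 1
    ring
  exact is_const_of_deriv_eq_zero (fun t => (hd t).differentiableAt) (fun t => (hd t).deriv) s t

/-- A sequence of solutions of `z'' = q z` with bounded initial data has a subsequence converging
pointwise to a solution. -/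
theorem exists_subseq_tendsto_solution (hq : Continuous q) {z z₁ : ℕ → ℝ → ℝ}
    (hz : ∀ n t, HasDerivAt (z n) (z₁ n t) t ∧ HasDerivAt (z₁ n) (q t * z n t) t) {C : ℝ}
    (hC : ∀ n, |z n 0| ≤ C ∧ |z₁ n 0| ≤ C) :
    ∃ w w₁ : ℝ → ℝ, (∀ t, HasDerivAt w (w₁ t) t ∧ HasDerivAt w₁ (q t * w t) t) ∧
      ∃ ψ : ℕ → ℕ, StrictMono ψ ∧
        ∀ t, Tendsto (fun n => z (ψ n) t) atTop (nhds (w t)) := by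
  obtain ⟨u, u₁, hu0, hu₁0, hu⟩ := exists_solution_second_order hq 1 0
  obtain ⟨v, v₁, hv0, hv₁0, hv⟩ := exists_solution_second_order hq 0 1
  have hrep : ∀ n t, z n t = z n 0 * u t + z₁ n 0 * v t := fun n t => by
    have huv := wronskian_eq hu hv t 0
    have hzu := wronskian_eq (hz n) hu t 0
    have hzv := wronskian_eq (hz n) hv t 0
    simp only [hu0, hu₁0, hv0, hv₁0] at huv hzu hzv
    linear_combination u t * hzv - v t * hzu - z n t * huv
  obtain ⟨⟨c, d⟩, -, ψ, hψ, hlim⟩ := tendsto_subseq_of_bounded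
    (Metric.isBounded_closedBall (x := (0 : ℝ × ℝ)) (r := C)) (x := fun n => (z n 0, z₁ n 0))
    fun n => by simpa [Prod.norm_def] using hC n
  refine ⟨fun t => c * u t + d * v t, fun t => c * u₁ t + d * v₁ t, fun t => ⟨?_, ?_⟩,
    ψ, hψ, fun t => ?_⟩
  · exact ((hu t).1.const_mul c).add ((hv t).1.const_mul d)
  · convert! ((hu t).2.const_mul c).add ((hv t).2.const_mul d) using 1
    ring
  · simp only [hrep _ t]
    rw [nhds_prod_eq] at hlim
    exact (hlim.fst.mul_const _).add (hlim.snd.mul_const _)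

theorem contDiff_two_of_solution (hq : Continuous q) {z z₁ : ℝ → ℝ}
    (hz : ∀ t, HasDerivAt z (z₁ t) t ∧ HasDerivAt z₁ (q t * z t) t) : ContDiff ℝ 2 z := by
  have hdz : deriv z = z₁ := funext fun t => (hz t).1.deriv
  have hdz₁ : deriv z₁ = fun t => q t * z t := funext fun t => (hz t).2.deriv
  have hz' : Differentiable ℝ z := fun t => (hz t).1.differentiableAt
  rw [show (2 : WithTop ℕ∞) = 1 + 1 by norm_num, contDiff_succ_iff_deriv, hdz,
    contDiff_one_iff_deriv, hdz₁]
  exact ⟨hz', by simp, fun t => (hz t).2.differentiableAt, hq.mul hz'.continuous⟩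

end SecondOrder

section FourthRoot

variable {r r₁ : ℝ → ℝ} {r₂ t : ℝ}

theorem sqrt_sqrt_pow_four {x : ℝ} (hx : 0 ≤ x) : √(√x) ^ 4 = x := by
  rw [show 4 = 2 * 2 from rfl, pow_mul, sq_sqrt (sqrt_nonneg _), sq_sqrt hx]

theorem hasDerivAt_sqrt_sqrt (hr : HasDerivAt r (r₁ t) t) (ht : 0 < r t) :
    HasDerivAt (fun s => √(√(r s))) (r₁ t / (4 * √(√(r t)) ^ 3)) t := by
  have hg : 0 < √(√(r t)) := sqrt_pos.2 (sqrt_pos.2 ht)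
  convert! (hr.sqrt ht.ne').sqrt (sqrt_pos.2 ht).ne' using 1
  nth_rw 2 [← sq_sqrt (sqrt_nonneg (r t))]
  field_simp
  norm_num

theorem hasDerivAt_deriv_sqrt_sqrt (hr : HasDerivAt r (r₁ t) t) (hr₁ : HasDerivAt r₁ r₂ t)
    (ht : 0 < r t) :
    HasDerivAt (fun s => r₁ s / (4 * √(√(r s)) ^ 3))
      ((4 * r t * r₂ - 5 * r₁ t ^ 2) / (16 * r t ^ ((5:ℝ) / 2)) * √(√(r t)) ^ 3 +
        2 * (r₁ t / (4 * √(√(r t)) ^ 3)) ^ 2 / √(√(r t))) t := by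
  have hg : 0 < √(√(r t)) := sqrt_pos.2 (sqrt_pos.2 ht)
  have h4 := sqrt_sqrt_pow_four ht.le
  have h10 : r t ^ ((5:ℝ) / 2) = √(√(r t)) ^ 10 := by
    nth_rw 1 [← h4]
    rw [← rpow_natCast, ← rpow_natCast, ← rpow_mul hg.le]
    norm_num
  convert! hr₁.div (((hasDerivAt_sqrt_sqrt hr ht).pow 3).const_mul 4)
    (mul_ne_zero four_ne_zero (pow_ne_zero 3 hg.ne')) using 1
  simp only [Pi.pow_apply]
  rw [h10]
  nth_rw 1 [← h4]
  field_simp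
  ring

end FourthRoot

section LGsol

variable {r z z₁ : ℝ → ℝ}

theorem LGsol_eventuallyEq (hr : Continuous r) (sign : ℝ) {t : ℝ} (ht : 0 < r t) :
    LGsol r (fun t => z t * √(√(r t)) * exp (-(sign * ∫ s in (0:ℝ)..t, √(r s))) - 1) sign
      =ᶠ[nhds t] z := by
  filter_upwards [hr.continuousAt.eventually (lt_mem_nhds ht)] with s hs
  have hg : 0 < √(√(r s)) := sqrt_pos.2 (sqrt_pos.2 hs)
  have h4 : r s ^ ((1:ℝ) / 4) = √(√(r s)) := by
    nth_rw 1 [← sqrt_sqrt_pow_four hs.le]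
    rw [← rpow_natCast, ← rpow_mul hg.le]
    norm_num
  rw [LGsol, h4, exp_neg, add_sub_cancel]
  field_simp

theorem contDiffOn_LGsol_and_deriv_deriv (hr : Continuous r)
    (hz : ∀ t, HasDerivAt z (z₁ t) t ∧ HasDerivAt z₁ (r t * z t) t) {δ : ℝ → ℝ} {sign : ℝ}
    (hδ : δ = fun t => z t * √(√(r t)) * exp (-(sign * ∫ s in (0:ℝ)..t, √(r s))) - 1)
    {K : Set ℝ} (hK : ∀ t ∈ K, 0 < r t) :
    ContDiffOn ℝ 2 (LGsol r δ sign) K ∧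
      ∀ t ∈ K, deriv (deriv (LGsol r δ sign)) t = r t * LGsol r δ sign t := by
  subst hδ
  refine ⟨(contDiff_two_of_solution hr hz).contDiffOn.congr fun t ht =>
    (LGsol_eventuallyEq hr sign (hK t ht)).eq_of_nhds, fun t ht => ?_⟩
  have heq := LGsol_eventuallyEq (z := z) hr sign (hK t ht)
  rw [heq.deriv.deriv_eq, heq.eq_of_nhds, funext fun s => (hz s).1.deriv]
  exact (hz t).2.deriv

end LGsol

section Existence

variable {r φ : ℝ → ℝ}

theorem hasDerivAt_integral_sqrt (hr : Continuous r) (t : ℝ) :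
    HasDerivAt (fun t => ∫ s in (0:ℝ)..t, √(r s)) (√(√(r t)) ^ 2) t := by
  rw [sq_sqrt (sqrt_nonneg _)]
  exact (hr.sqrt.integral_hasStrictDerivAt 0 t).hasDerivAt

theorem hasDerivAt_and_hasDerivAt_deriv (hr2 : ContDiff ℝ 2 r) (t : ℝ) :
    HasDerivAt r (deriv r t) t ∧ HasDerivAt (deriv r) (deriv (deriv r) t) t :=
  ⟨(hr2.differentiable two_ne_zero t).hasDerivAt,
    ((contDiff_one_iff_deriv.1 ((contDiff_succ_iff_deriv (n := 1)).1 hr2).2.2).1 t).hasDerivAt⟩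

theorem continuousOn_errorControl (hr_pos : ∀ t ∈ Ici (0:ℝ), 0 < r t) (hr2 : ContDiff ℝ 2 r)
    (hφ : ∀ t, φ t
      = (4 * r t * deriv (deriv r) t - 5 * deriv r t ^ 2) / (16 * r t ^ ((5:ℝ)/2))) :
    ContinuousOn φ (Ici 0) := by
  have h1 := (contDiff_succ_iff_deriv (n := 1)).1 hr2
  have h2 := (contDiff_one_iff_deriv.1 h1.2.2).2
  rw [funext hφ]
  refine ContinuousOn.div (((hr2.continuous.const_mul 4).mul h2).sub
    ((h1.2.2.continuous.pow 2).const_mul 5)).continuousOn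
    ((hr2.continuous.continuousOn.rpow_const fun t ht => Or.inl (hr_pos t ht).ne').const_mul 16)
    fun t ht => ?_
  have := hr_pos t ht
  positivity

theorem exists_growing_solution (hr_pos : ∀ t ∈ Ici (0:ℝ), 0 < r t) (hr2 : ContDiff ℝ 2 r)
    (hφ : ∀ t, φ t
      = (4 * r t * deriv (deriv r) t - 5 * deriv r t ^ 2) / (16 * r t ^ ((5:ℝ)/2))) :
    ∃ z z₁ : ℝ → ℝ, (∀ t, HasDerivAt z (z₁ t) t ∧ HasDerivAt z₁ (r t * z t) t) ∧
      ∀ t ∈ Ici (0:ℝ), |z t * √(√(r t)) * exp (-∫ s in (0:ℝ)..t, √(r s)) - 1| ≤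
        exp (1 / 2 * ∫ s in (0:ℝ)..t, |φ s|) - 1 := by
  set g : ℝ → ℝ := fun t => √(√(r t)) with hg
  set g₁ : ℝ → ℝ := fun t => deriv r t / (4 * g t ^ 3) with hg₁
  have hgpos : ∀ t ∈ Ici (0:ℝ), 0 < g t := fun t ht => sqrt_pos.2 (sqrt_pos.2 (hr_pos t ht))
  have hg0 := (hgpos 0 self_mem_Ici).ne'
  obtain ⟨z, z₁, hz0, hz₁0, hz⟩ := exists_solution_second_order hr2.continuous
    (g 0)⁻¹ (g 0 - g₁ 0 / g 0 ^ 2)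
  refine ⟨z, z₁, hz, fun t ht => ?_⟩
  have hd := hasDerivAt_and_hasDerivAt_deriv hr2
  refine (liouvilleGreen_error_bound (g := g) (g₁ := g₁) (T := t)
    (fun s hs => hgpos s hs.1) (fun s hs => hasDerivAt_sqrt_sqrt (hd s).1 (hr_pos s hs.1))
    (fun s hs => ?_) (fun s _ => hasDerivAt_integral_sqrt hr2.continuous s)
    ((continuousOn_errorControl hr_pos hr2 hφ).mono Icc_subset_Ici_self) (fun s _ => (hz s).1)
    (fun s hs => ?_) (by simp) ?_ ?_ t (right_mem_Icc.2 ht)).1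
  · rw [hφ]
    exact hasDerivAt_deriv_sqrt_sqrt (hd s).1 (hd s).2 (hr_pos s hs.1)
  · rw [sqrt_sqrt_pow_four (hr_pos s hs.1).le]
    exact (hz s).2
  · rw [hz0, inv_mul_cancel₀ hg0]
  · rw [hz0, hz₁0]
    field_simp
    ring

theorem exists_decaying_solution (hr_pos : ∀ t ∈ Ici (0:ℝ), 0 < r t) (hr2 : ContDiff ℝ 2 r)
    (hφ : ∀ t, φ t
      = (4 * r t * deriv (deriv r) t - 5 * deriv r t ^ 2) / (16 * r t ^ ((5:ℝ)/2)))
    {T : ℝ} (hT : 0 ≤ T) :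
    ∃ z z₁ : ℝ → ℝ, (∀ t, HasDerivAt z (z₁ t) t ∧ HasDerivAt z₁ (r t * z t) t) ∧
      ∀ t ∈ Icc 0 T,
        |z t * √(√(r t)) * exp (∫ s in (0:ℝ)..t, √(r s)) - 1| ≤
          exp (1 / 2 * ∫ s in t..T, |φ s|) - 1 ∧
        |(z₁ t * √(√(r t)) + z t * (deriv r t / (4 * √(√(r t)) ^ 3)) + z t * √(√(r t)) ^ 3) /
            √(√(r t)) ^ 2 * exp (∫ s in (0:ℝ)..t, √(r s))| ≤
          2 * (exp (1 / 2 * ∫ s in t..T, |φ s|) - 1) := by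
  set g : ℝ → ℝ := fun t => √(√(r t)) with hg
  set g₁ : ℝ → ℝ := fun t => deriv r t / (4 * g t ^ 3) with hg₁
  have hgpos : ∀ t ∈ Ici (0:ℝ), 0 < g t := fun t ht => sqrt_pos.2 (sqrt_pos.2 (hr_pos t ht))
  have hgT := (hgpos T hT).ne'
  obtain ⟨z, z₁, hzT, hz₁T, hz⟩ := exists_solution_second_order_at hr2.continuous T
    (exp (-∫ s in (0:ℝ)..T, √(r s)) / g T)
    (-(exp (-∫ s in (0:ℝ)..T, √(r s)) / g T) * (g₁ T / g T + g T ^ 2))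
  refine ⟨z, z₁, hz, ?_⟩
  have hd := hasDerivAt_and_hasDerivAt_deriv hr2
  refine liouvilleGreen_error_bound_right (g := g) (g₁ := g₁)
    (S := fun t => ∫ s in (0:ℝ)..t, √(r s))
    (fun s hs => hgpos s hs.1) (fun s hs => hasDerivAt_sqrt_sqrt (hd s).1 (hr_pos s hs.1))
    (fun s hs => ?_) (fun s _ => hasDerivAt_integral_sqrt hr2.continuous s)
    ((continuousOn_errorControl hr_pos hr2 hφ).mono Icc_subset_Ici_self) (fun s _ => (hz s).1)
    (fun s hs => ?_) ?_ ?_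
  · rw [hφ]
    exact hasDerivAt_deriv_sqrt_sqrt (hd s).1 (hd s).2 (hr_pos s hs.1)
  · rw [sqrt_sqrt_pow_four (hr_pos s hs.1).le]
    exact (hz s).2
  · rw [hzT, exp_neg]
    field_simp
  · rw [hzT, hz₁T]
    field_simp
    ring

theorem exists_decaying_solution_of_integrableOn (hr_pos : ∀ t ∈ Ici (0:ℝ), 0 < r t)
    (hr2 : ContDiff ℝ 2 r)
    (hφ : ∀ t, φ t
      = (4 * r t * deriv (deriv r) t - 5 * deriv r t ^ 2) / (16 * r t ^ ((5:ℝ)/2)))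
    (h_int : IntegrableOn (fun s => |φ s|) (Ici 0)) :
    ∃ z z₁ : ℝ → ℝ, (∀ t, HasDerivAt z (z₁ t) t ∧ HasDerivAt z₁ (r t * z t) t) ∧
      ∀ t ∈ Ici (0:ℝ), |z t * √(√(r t)) * exp (∫ s in (0:ℝ)..t, √(r s)) - 1| ≤
        exp (1 / 2 * ∫ s in Ioi t, |φ s|) - 1 := by
  choose z z₁ hz hbound using fun n : ℕ =>
    exists_decaying_solution hr_pos hr2 hφ (Nat.cast_nonneg (α := ℝ) n)
  have htail : ∀ {t T : ℝ}, 0 ≤ t → t ≤ T →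
      exp (1 / 2 * ∫ s in t..T, |φ s|) ≤ exp (1 / 2 * ∫ s in Ioi t, |φ s|) := fun ht htT => by
    rw [intervalIntegral.integral_of_le htT]
    refine exp_le_exp.2 (mul_le_mul_of_nonneg_left ?_ (by norm_num))
    exact setIntegral_mono_set (h_int.mono_set fun s hs => ht.trans hs.le)
      (Eventually.of_forall fun s => abs_nonneg _) Ioc_subset_Ioi_self.eventuallyLE
  have hg0 : 0 < √(√(r 0)) := sqrt_pos.2 (sqrt_pos.2 (hr_pos 0 self_mem_Ici))
  set g₀ := √(√(r 0)) with hg₀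
  set k := deriv r 0 / (4 * g₀ ^ 3) + g₀ ^ 3 with hk
  set B := exp (1 / 2 * ∫ s in Ioi (0:ℝ), |φ s|) with hB
  have hbz : ∀ n, |z n 0| ≤ B / g₀ := fun n => by
    have h1 := (hbound n 0 ⟨le_rfl, n.cast_nonneg⟩).1
    simp only [intervalIntegral.integral_same, exp_zero, mul_one] at h1
    have h2 := abs_sub_abs_le_abs_sub (z n 0 * g₀) 1
    rw [abs_one, abs_mul, abs_of_pos hg0] at h2
    rw [le_div_iff₀ hg0]
    linarith [htail le_rfl (n.cast_nonneg (α := ℝ))]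
  have hbz₁ : ∀ n, |z₁ n 0| ≤ (2 * (B - 1) * g₀ ^ 2 + B / g₀ * |k|) / g₀ := fun n => by
    have h1 := (hbound n 0 ⟨le_rfl, n.cast_nonneg⟩).2
    simp only [intervalIntegral.integral_same, exp_zero, mul_one] at h1
    rw [abs_div, abs_of_pos (pow_pos hg0 2), div_le_iff₀ (pow_pos hg0 2)] at h1
    have h2 : |z₁ n 0 * g₀| - |-(z n 0 * k)| ≤ |z₁ n 0 * g₀ - -(z n 0 * k)| :=
      abs_sub_abs_le_abs_sub _ _
    have h3 : z₁ n 0 * g₀ - -(z n 0 * k) =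
        z₁ n 0 * g₀ + z n 0 * (deriv r 0 / (4 * g₀ ^ 3)) + z n 0 * g₀ ^ 3 := by rw [hk]; ring
    rw [h3, abs_neg, abs_mul, abs_mul, abs_of_pos hg0] at h2
    rw [le_div_iff₀ hg0]
    have h4 := mul_le_mul_of_nonneg_right (hbz n) (abs_nonneg k)
    have h5 := mul_le_mul_of_nonneg_right (htail le_rfl (n.cast_nonneg (α := ℝ)))
      (pow_pos hg0 2).le
    linarith
  obtain ⟨w, w₁, hw, ψ, hψ, hlim⟩ := exists_subseq_tendsto_solution hr2.continuous hz
    fun n => ⟨(hbz n).trans (le_max_left _ _), (hbz₁ n).trans (le_max_right _ _)⟩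
  refine ⟨w, w₁, hw, fun t ht => ?_⟩
  refine le_of_tendsto ((((hlim t).mul_const _).mul_const _).sub_const 1).abs ?_
  filter_upwards [(tendsto_natCast_atTop_atTop (R := ℝ)).comp hψ.tendsto_atTop
    |>.eventually_ge_atTop t] with n hn
  exact (hbound (ψ n) t ⟨ht, hn⟩).1.trans (sub_le_sub_right (htail ht hn) 1)

end Existence

theorem stmt13 (r φ : ℝ → ℝ)
    (hr_pos : ∀ t ∈ Set.Ici (0:ℝ), 0 < r t) (hr2 : ContDiff ℝ 2 r)
    (hφ : ∀ t, φ t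
      = (4 * r t * deriv (deriv r) t - 5 * deriv r t ^ 2) / (16 * r t ^ ((5:ℝ)/2))) :
    (∀ T > (0:ℝ), ∃ δ1 δ2 : ℝ → ℝ,
      (∀ t ∈ Set.Icc (0:ℝ) T,
        |δ1 t| ≤ Real.exp (1/2 * ∫ s in (0:ℝ)..t, |φ s|) - 1 ∧
        |δ2 t| ≤ Real.exp (1/2 * ∫ s in t..T, |φ s|) - 1) ∧
      ContDiffOn ℝ 2 (LGsol r δ1 1) (Set.Icc 0 T) ∧
      ContDiffOn ℝ 2 (LGsol r δ2 (-1)) (Set.Icc 0 T) ∧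
      (∀ t ∈ Set.Icc (0:ℝ) T,
        deriv (deriv (LGsol r δ1 1)) t = r t * LGsol r δ1 1 t ∧
        deriv (deriv (LGsol r δ2 (-1))) t = r t * LGsol r δ2 (-1) t)) ∧
    (MeasureTheory.IntegrableOn (fun s => |φ s|) (Set.Ici 0) →
      ∃ δ1 δ2 : ℝ → ℝ,
        (∀ t ∈ Set.Ici (0:ℝ),
          |δ1 t| ≤ Real.exp (1/2 * ∫ s in (0:ℝ)..t, |φ s|) - 1 ∧
          |δ2 t| ≤ Real.exp (1/2 * ∫ s in Set.Ioi t, |φ s|) - 1) ∧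
        ContDiffOn ℝ 2 (LGsol r δ1 1) (Set.Ici 0) ∧
        ContDiffOn ℝ 2 (LGsol r δ2 (-1)) (Set.Ici 0) ∧
        (∀ t ∈ Set.Ici (0:ℝ),
          deriv (deriv (LGsol r δ1 1)) t = r t * LGsol r δ1 1 t ∧
          deriv (deriv (LGsol r δ2 (-1))) t = r t * LGsol r δ2 (-1) t)) := by
  have hr := hr2.continuous
  obtain ⟨z, z₁, hz, hzb⟩ := exists_growing_solution hr_pos hr2 hφ
  refine ⟨fun T hT => ?_, fun h_int => ?_⟩
  · obtain ⟨w, w₁, hw, hwb⟩ := exists_decaying_solution hr_pos hr2 hφ hT.le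
    have hK : ∀ t ∈ Icc (0:ℝ) T, 0 < r t := fun t ht => hr_pos t ht.1
    obtain ⟨hz2, hzd⟩ := contDiffOn_LGsol_and_deriv_deriv hr hz (sign := 1) rfl hK
    obtain ⟨hw2, hwd⟩ := contDiffOn_LGsol_and_deriv_deriv hr hw (sign := -1) rfl hK
    refine ⟨_, _, fun t ht => ⟨?_, ?_⟩, hz2, hw2, fun t ht => ⟨hzd t ht, hwd t ht⟩⟩
    · simpa using hzb t ht.1
    · simpa using (hwb t ht).1
  · obtain ⟨w, w₁, hw, hwb⟩ := exists_decaying_solution_of_integrableOn hr_pos hr2 hφ h_int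
    obtain ⟨hz2, hzd⟩ := contDiffOn_LGsol_and_deriv_deriv hr hz (sign := 1) rfl hr_pos
    obtain ⟨hw2, hwd⟩ := contDiffOn_LGsol_and_deriv_deriv hr hw (sign := -1) rfl hr_pos
    refine ⟨_, _, fun t ht => ⟨?_, ?_⟩, hz2, hw2, fun t ht => ⟨hzd t ht, hwd t ht⟩⟩
    · simpa using hzb t ht
    · simpa using hwb t ht
end

section
/- Suppose ε and α are three times continuously differentiable with ε(0) < (βλ)²/(2|α'(t)| + 4λ) for all t ≥ 0, the first, second and third derivatives of ε and α are integrable on [0,∞), ε(t) → 0 as t → ∞, and ε'(t)²/ε(t) is integrable on [0,∞). Define p(t) = (α(t)+βλ)/ε(t), r(t) = p(t)²/4 + p'(t)/2 − λ/ε(t), and φ(t) = (4r(t)r''(t) − 5r'(t)²)/(16 r(t)^{5/2}). Then ∫₀^∞ |φ(s)| ds < +∞. -/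
open Real Filter MeasureTheory Set

/-- A `C¹` function whose derivative is integrable on `[0, ∞)` is bounded there. -/
theorem memLp_top_of_integrableOn_deriv {f : ℝ → ℝ} (hf : ContDiff ℝ 1 f)
    (hf' : IntegrableOn (deriv f) (Set.Ici 0)) :
    MemLp f ⊤ (volume.restrict (Set.Ioi (0:ℝ))) := by
  refine memLp_top_of_bound hf.continuous.aestronglyMeasurable
    (‖f 0‖ + ∫ x in Set.Ioi (0:ℝ), ‖deriv f x‖) ?_
  filter_upwards [ae_restrict_mem measurableSet_Ioi] with t ht
  have hftc : ∫ x in (0:ℝ)..t, deriv f x = f t - f 0 :=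
    intervalIntegral.integral_deriv_eq_sub (fun x _ => hf.differentiable one_ne_zero x)
      ((hf.continuous_deriv le_rfl).intervalIntegrable _ _)
  have hbound : ‖∫ x in (0:ℝ)..t, deriv f x‖ ≤ ∫ x in Set.Ioi (0:ℝ), ‖deriv f x‖ := by
    rw [intervalIntegral.integral_of_le (le_of_lt ht)]
    refine (norm_integral_le_integral_norm _).trans ?_
    exact setIntegral_mono_set (hf'.mono_set Set.Ioi_subset_Ici_self).norm
      (Eventually.of_forall fun _ => norm_nonneg _)
      (Set.Ioc_subset_Ioi_self.eventuallyLE)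
  calc ‖f t‖ = ‖f 0 + ∫ x in (0:ℝ)..t, deriv f x‖ := by rw [hftc]; ring_nf
    _ ≤ _ := (norm_add_le _ _).trans (by gcongr)

/-- A continuous function on `[0, ∞)` that is positive, and eventually at least `c > 0`,
is bounded below by a positive constant. -/
theorem exists_pos_forall_le_of_eventually_le {q : ℝ → ℝ} (hq : Continuous q)
    (hpos : ∀ t, 0 ≤ t → 0 < q t) {c : ℝ} (hc : 0 < c) (hev : ∀ᶠ t in atTop, c ≤ q t) :
    ∃ d, 0 < d ∧ ∀ t, 0 ≤ t → d ≤ q t := by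
  obtain ⟨T, hT⟩ := eventually_atTop.1 hev
  obtain ⟨s, hs, hmin⟩ := (isCompact_Icc (a := (0:ℝ)) (b := max T 0)).exists_isMinOn
    ⟨0, by simp⟩ hq.continuousOn
  refine ⟨min c (q s), lt_min hc (hpos s hs.1), fun t ht => ?_⟩
  rcases le_total t (max T 0) with h | h
  · exact (min_le_right _ _).trans (hmin ⟨ht, h⟩)
  · exact (min_le_left _ _).trans (hT t ((le_max_left _ _).trans h))

/-- The quantity `(4 r r'' - 5 r'²) / (16 r^(5/2))` for `r = q / (4 e²)`, expressed through the
derivatives `q₁, q₂` of `q` and `e₁, e₂` of `e`. -/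
theorem liouville_green_error_eq {q e : ℝ} (hq : 0 < q) (he : 0 < e) (q₁ q₂ e₁ e₂ : ℝ) :
    (4 * (q / (4 * e ^ 2))
        * (q₂ / (4 * e ^ 2) - q₁ * e₁ / e ^ 3 - q * e₂ / (2 * e ^ 3)
          + 3 * q * e₁ ^ 2 / (2 * e ^ 4))
      - 5 * (q₁ / (4 * e ^ 2) - q * e₁ / (2 * e ^ 3)) ^ 2)
      / (16 * (q / (4 * e ^ 2)) ^ ((5:ℝ) / 2))
    = q ^ (-((5:ℝ) / 2)) * (q * e * q₂ / 2 + q * q₁ * e₁ / 2 - q ^ 2 * e₂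
      + q ^ 2 * (e₁ ^ 2 / e) / 2 - 5 / 8 * (e * q₁ * q₁)) := by
  have h : (4 * e ^ 2) ^ ((5:ℝ) / 2) = 32 * e ^ 5 := by
    rw [show 4 * e ^ 2 = (2 * e) ^ (2:ℝ) by rw [Real.rpow_two]; ring,
      ← Real.rpow_mul (by positivity), show (2:ℝ) * (5 / 2) = (5:ℕ) by norm_num,
      Real.rpow_natCast]
    ring
  rw [Real.div_rpow hq.le (by positivity), h, Real.rpow_neg hq.le]
  have hq' : 0 < q ^ ((5:ℝ) / 2) := Real.rpow_pos_of_pos hq _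
  generalize q ^ ((5:ℝ) / 2) = w at hq' ⊢
  field_simp
  ring

/-- First derivative of `q / (4 e²)`. -/
theorem hasDerivAt_div_four_mul_sq {q e : ℝ → ℝ} {q₁ e₁ t : ℝ} (hq : HasDerivAt q q₁ t)
    (he : HasDerivAt e e₁ t) (het : e t ≠ 0) :
    HasDerivAt (fun s => q s / (4 * e s ^ 2))
      (q₁ / (4 * e t ^ 2) - q t * e₁ / (2 * e t ^ 3)) t := by
  refine (hq.div ((he.pow 2).const_mul 4) (by simpa using het)).congr_deriv ?_
  simp only [Pi.pow_apply]
  field_simp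
  norm_num
  ring

/-- Second derivative of `q / (4 e²)`. -/
theorem hasDerivAt_deriv_div_four_mul_sq {q q₁ e e₁ : ℝ → ℝ} {q₂ e₂ t : ℝ}
    (hq : HasDerivAt q (q₁ t) t) (hq₁ : HasDerivAt q₁ q₂ t)
    (he : HasDerivAt e (e₁ t) t) (he₁ : HasDerivAt e₁ e₂ t) (het : e t ≠ 0) :
    HasDerivAt (fun s => q₁ s / (4 * e s ^ 2) - q s * e₁ s / (2 * e s ^ 3))
      (q₂ / (4 * e t ^ 2) - q₁ t * e₁ t / e t ^ 3 - q t * e₂ / (2 * e t ^ 3)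
        + 3 * q t * e₁ t ^ 2 / (2 * e t ^ 4)) t := by
  refine ((hasDerivAt_div_four_mul_sq hq₁ he het).sub
    ((hq.mul he₁).div ((he.pow 3).const_mul 2) (by simpa using het))).congr_deriv ?_
  simp only [Pi.pow_apply, Pi.mul_apply]
  field_simp
  norm_num
  ring

theorem stmt14
    (lam β : ℝ) (hlam : 0 < lam) (hβ : 0 < β)
    (ε α : ℝ → ℝ)
    (hε_anti : AntitoneOn ε (Set.Ici 0)) (hε_pos : ∀ t ∈ Set.Ici (0:ℝ), 0 < ε t)
    (hα_anti : AntitoneOn α (Set.Ici 0)) (hα_nonneg : ∀ t ∈ Set.Ici (0:ℝ), 0 ≤ α t)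
    (hε3 : ContDiff ℝ 3 ε) (hα3 : ContDiff ℝ 3 α)
    (hsmall : ∀ t ∈ Set.Ici (0:ℝ), ε 0 < (β * lam) ^ 2 / (2 * |deriv α t| + 4 * lam))
    (hε1 : MeasureTheory.IntegrableOn (deriv ε) (Set.Ici 0))
    (hε2 : MeasureTheory.IntegrableOn (deriv (deriv ε)) (Set.Ici 0))
    (hε3' : MeasureTheory.IntegrableOn (deriv (deriv (deriv ε))) (Set.Ici 0))
    (hα1 : MeasureTheory.IntegrableOn (deriv α) (Set.Ici 0))
    (hα2 : MeasureTheory.IntegrableOn (deriv (deriv α)) (Set.Ici 0))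
    (hα3' : MeasureTheory.IntegrableOn (deriv (deriv (deriv α))) (Set.Ici 0))
    (hεlim : Filter.Tendsto ε Filter.atTop (nhds 0))
    (hεsq : MeasureTheory.IntegrableOn (fun t => deriv ε t ^ 2 / ε t) (Set.Ici 0))
    (p r φ : ℝ → ℝ)
    (hp : ∀ t, p t = (α t + β * lam) / ε t)
    (hr : ∀ t, r t = p t ^ 2 / 4 + deriv p t / 2 - lam / ε t)
    (hφ : ∀ t, φ t
      = (4 * r t * deriv (deriv r) t - 5 * deriv r t ^ 2) / (16 * r t ^ ((5:ℝ)/2))) :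
    MeasureTheory.IntegrableOn (fun s => |φ s|) (Set.Ici 0) := by
  have cε1 : ContDiff ℝ 2 (deriv ε) := hε3.deriv'
  have cα1 : ContDiff ℝ 2 (deriv α) := hα3.deriv'
  have cε2 : ContDiff ℝ 1 (deriv (deriv ε)) := cε1.deriv'
  have cα2 : ContDiff ℝ 1 (deriv (deriv α)) := cα1.deriv'
  have dε (t) : HasDerivAt ε (deriv ε t) t := (hε3.differentiable (by norm_num) t).hasDerivAt
  have dα (t) : HasDerivAt α (deriv α t) t := (hα3.differentiable (by norm_num) t).hasDerivAt
  have dε1 (t) : HasDerivAt (deriv ε) (deriv (deriv ε) t) t :=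
    (cε1.differentiable (by norm_num) t).hasDerivAt
  have dα1 (t) : HasDerivAt (deriv α) (deriv (deriv α) t) t :=
    (cα1.differentiable (by norm_num) t).hasDerivAt
  have dε2 (t) : HasDerivAt (deriv (deriv ε)) (deriv (deriv (deriv ε)) t) t :=
    (cε2.differentiable (by norm_num) t).hasDerivAt
  have dα2 (t) : HasDerivAt (deriv (deriv α)) (deriv (deriv (deriv α)) t) t :=
    (cα2.differentiable (by norm_num) t).hasDerivAt
  -- boundedness and integrability of the data on `(0, ∞)`
  have bε := memLp_top_of_integrableOn_deriv (hε3.of_le (by norm_num)) hε1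
  have bα := memLp_top_of_integrableOn_deriv (hα3.of_le (by norm_num)) hα1
  have bε1 := memLp_top_of_integrableOn_deriv (cε1.of_le (by norm_num)) hε2
  have bα1 := memLp_top_of_integrableOn_deriv (cα1.of_le (by norm_num)) hα2
  have bε2 := memLp_top_of_integrableOn_deriv cε2 hε3'
  have bα2 := memLp_top_of_integrableOn_deriv cα2 hα3'
  simp only [IntegrableOn, ← restrict_Ioi_eq_restrict_Ici] at *
  set μ := volume.restrict (Set.Ioi (0:ℝ))
  -- `r = q / (4 ε²)`, with `q₁`, `q₂` the derivatives of `q`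
  let a : ℝ → ℝ := fun t => α t + β * lam
  let q : ℝ → ℝ := fun t => a t * a t + 2 * (deriv α t * ε t) - 2 * (a t * deriv ε t)
    - 4 * lam * ε t
  let q₁ : ℝ → ℝ := fun t => 2 * (a t * deriv α t) + 2 * (ε t * deriv (deriv α) t)
    - 2 * (a t * deriv (deriv ε) t) - 4 * lam * deriv ε t
  let q₂ : ℝ → ℝ := fun t => 2 * (deriv α t * deriv α t) + 2 * (a t * deriv (deriv α) t)
    + 2 * (deriv ε t * deriv (deriv α) t) + 2 * (ε t * deriv (deriv (deriv α)) t)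
    - 2 * (deriv α t * deriv (deriv ε) t) - 2 * (a t * deriv (deriv (deriv ε)) t)
    - 4 * lam * deriv (deriv ε) t
  have da (t) : HasDerivAt a (deriv α t) t := (dα t).add_const _
  have dq (t) : HasDerivAt q (q₁ t) t :=
    (((((da t).mul (da t)).add (((dα1 t).mul (dε t)).const_mul 2)).sub
      (((da t).mul (dε1 t)).const_mul 2)).sub ((dε t).const_mul (4 * lam))).congr_deriv
      (by simp only [q₁]; ring)
  have dq₁ (t) : HasDerivAt q₁ (q₂ t) t :=
    ((((((da t).mul (dα1 t)).const_mul 2).add (((dε t).mul (dα2 t)).const_mul 2)).sub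
      (((da t).mul (dε2 t)).const_mul 2)).sub ((dε1 t).const_mul (4 * lam))).congr_deriv
      (by simp only [q₂]; ring)
  have hqc : Continuous q := continuous_iff_continuousAt.2 fun t => (dq t).continuousAt
  have hlower (t) (ht : 0 ≤ t) : (β * lam) ^ 2 - ε t * (2 * |deriv α t| + 4 * lam) ≤ q t := by
    have h1 : deriv ε t ≤ 0 := by
      have hnonpos : derivWithin ε (Set.Ici 0) t ≤ 0 := hε_anti.derivWithin_nonpos
      rwa [(dε t).hasDerivWithinAt.derivWithin (uniqueDiffOn_Ici 0 t ht)] at hnonpos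
    have h2 : β * lam ≤ a t := by have := hα_nonneg t ht; simp only [a]; linarith
    have h3 : 0 < β * lam := mul_pos hβ hlam
    have h4 : 0 ≤ (deriv α t + |deriv α t|) * ε t :=
      mul_nonneg (by linarith [neg_abs_le (deriv α t)]) (hε_pos t ht).le
    simp only [q]
    nlinarith [mul_nonneg (h3.le.trans h2) (neg_nonneg.2 h1)]
  have hqpos (t) (ht : 0 ≤ t) : 0 < q t := by
    refine lt_of_lt_of_le ?_ (hlower t ht)
    have h1 := (lt_div_iff₀ (by positivity)).1 (hsmall t ht)
    have h2 : ε t ≤ ε 0 := hε_anti (Set.mem_Ici.2 le_rfl) ht ht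
    have h3 : 0 ≤ 2 * |deriv α t| + 4 * lam := by positivity
    nlinarith [mul_le_mul_of_nonneg_right h2 h3]
  obtain ⟨d, hd, hdq⟩ : ∃ d, 0 < d ∧ ∀ t, 0 ≤ t → d ≤ q t := by
    have h0 : 0 < (β * lam) ^ 2 := by positivity
    refine exists_pos_forall_le_of_eventually_le hqc hqpos (half_pos h0) ?_
    have hε0 : 0 < ε 0 := hε_pos 0 Set.self_mem_Ici
    filter_upwards [hεlim.eventually_le_const (half_pos hε0), eventually_ge_atTop 0]
      with t hεt ht
    refine le_trans ?_ (hlower t ht)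
    have h1 := (lt_div_iff₀ (by positivity)).1 (hsmall t ht)
    have h2 : 0 ≤ 2 * |deriv α t| + 4 * lam := by positivity
    nlinarith [mul_le_mul_of_nonneg_right hεt h2]
  -- the Liouville–Green error in terms of `q` and `ε`
  have hrq (t) (ht : 0 < t) : r t = q t / (4 * ε t ^ 2) := by
    have hε0 : ε t ≠ 0 := (hε_pos t ht.le).ne'
    have hp' : deriv p t = (deriv α t * ε t - a t * deriv ε t) / ε t ^ 2 := by
      rw [show p = fun s => a s / ε s from funext hp]
      exact ((da t).div (dε t) hε0).deriv
    rw [hr, hp', hp]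
    simp only [q, a]
    field_simp
    ring
  have hr₁ (t) (ht : 0 < t) :
      deriv r t = q₁ t / (4 * ε t ^ 2) - q t * deriv ε t / (2 * ε t ^ 3) := by
    have heq : r =ᶠ[nhds t] fun s => q s / (4 * ε s ^ 2) := by
      filter_upwards [Ioi_mem_nhds ht] with s hs using hrq s hs
    rw [heq.deriv_eq]
    exact (hasDerivAt_div_four_mul_sq (dq t) (dε t) (hε_pos t ht.le).ne').deriv
  have hr₂ (t) (ht : 0 < t) :
      deriv (deriv r) t = q₂ t / (4 * ε t ^ 2) - q₁ t * deriv ε t / ε t ^ 3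
        - q t * deriv (deriv ε) t / (2 * ε t ^ 3)
        + 3 * q t * deriv ε t ^ 2 / (2 * ε t ^ 4) := by
    have heq : deriv r =ᶠ[nhds t]
        fun s => q₁ s / (4 * ε s ^ 2) - q s * deriv ε s / (2 * ε s ^ 3) := by
      filter_upwards [Ioi_mem_nhds ht] with s hs using hr₁ s hs
    rw [heq.deriv_eq]
    exact (hasDerivAt_deriv_div_four_mul_sq (dq t) (dq₁ t) (dε t) (dε1 t)
      (hε_pos t ht.le).ne').deriv
  -- integrability of the individual terms
  have mul_top {f g : ℝ → ℝ} (hf : MemLp f ⊤ μ) (hg : MemLp g ⊤ μ) :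
      MemLp (fun t => f t * g t) ⊤ μ := hg.mul hf
  have mul_int {f g : ℝ → ℝ} (hf : MemLp f ⊤ μ) (hg : Integrable g μ) :
      Integrable (fun t => f t * g t) μ := hg.mul_of_top_right hf
  have ba : MemLp a ⊤ μ := bα.add (memLp_top_const _)
  have bq : MemLp q ⊤ μ :=
    (((mul_top ba ba).add ((mul_top bα1 bε).const_mul 2)).sub
      ((mul_top ba bε1).const_mul 2)).sub (bε.const_mul (4 * lam))
  have bq₁ : MemLp q₁ ⊤ μ :=
    ((((mul_top ba bα1).const_mul 2).add ((mul_top bε bα2).const_mul 2)).sub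
      ((mul_top ba bε2).const_mul 2)).sub (bε1.const_mul (4 * lam))
  have iq₁ : Integrable q₁ μ :=
    ((((mul_int ba hα1).const_mul 2).add ((mul_int bε hα2).const_mul 2)).sub
      ((mul_int ba hε2).const_mul 2)).sub (hε1.const_mul (4 * lam))
  have iq₂ : Integrable q₂ μ :=
    (((((((mul_int bα1 hα1).const_mul 2).add ((mul_int ba hα2).const_mul 2)).add
      ((mul_int bε1 hα2).const_mul 2)).add ((mul_int bε hα3').const_mul 2)).sub
      ((mul_int bα1 hε2).const_mul 2)).sub ((mul_int ba hε3').const_mul 2)).sub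
      (hε2.const_mul (4 * lam))
  have bqq : MemLp (fun t => q t ^ 2) ⊤ μ := by simpa only [sq] using mul_top bq bq
  have bw : MemLp (fun t => q t ^ (-((5:ℝ) / 2))) ⊤ μ := by
    refine memLp_top_of_bound (hqc.measurable.pow_const _).aestronglyMeasurable
      (d ^ (-((5:ℝ) / 2))) ?_
    filter_upwards [ae_restrict_mem measurableSet_Ioi] with t ht
    rw [Real.norm_of_nonneg (Real.rpow_nonneg (hqpos t (le_of_lt ht)).le _)]
    exact Real.rpow_le_rpow_of_nonpos hd (hdq t (le_of_lt ht)) (by norm_num)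
  have key := mul_int bw
    ((((((mul_int (mul_top bq bε) iq₂).div_const 2).add
      ((mul_int (mul_top bq bq₁) hε1).div_const 2)).sub (mul_int bqq hε2)).add
      ((mul_int bqq hεsq).div_const 2)).sub ((mul_int (mul_top bε bq₁) iq₁).const_mul (5 / 8)))
  refine Integrable.abs (key.congr ?_)
  filter_upwards [ae_restrict_mem measurableSet_Ioi] with t (ht : 0 < t)
  rw [hφ, hrq t ht, hr₁ t ht, hr₂ t ht,
    liouville_green_error_eq (hqpos t ht.le) (hε_pos t ht.le)]
  rfl
end

section
/- Suppose ε and α are three times continuously differentiable with ε(0) < (βλ)²/(2|α'(t)| + 4λ) for all t ≥ 0, the first, second and third derivatives of ε and α are integrable on [0,∞), ε(t) → 0 as t → ∞, and ε'(t)²/ε(t) is integrable on [0,∞). Let x solve ε(t)ẍ(t) + (α(t)+βλ)ẋ(t) + λx(t) = 0 with x(0) = x0, ẋ(0) = ẋ0, and let p(t) = (α(t)+βλ)/ε(t), r(t) = p(t)²/4 + p'(t)/2 − λ/ε(t), φ(t) = (4r(t)r''(t) − 5r'(t)²)/(16 r(t)^{5/2}). Then there exist constants A, B ∈ ℝ and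 functions δ1, δ2 with |δ1(t)| ≤ exp((1/2)∫₀ᵗ |φ(s)| ds) − 1 and |δ2(t)| ≤ exp((1/2)∫ₜ^∞ |φ(s)| ds) − 1 for all t ≥ 0, such that for all t ≥ 0, x(t) = A ((1+δ1(t))/r(t)^{1/4}) exp(∫₀ᵗ (−p(s)/2 + √(r(s))) ds) + B ((1+δ2(t))/r(t)^{1/4}) exp(∫₀ᵗ (−p(s)/2 − √(r(s))) ds). -/
open Real Filter MeasureTheory Set

open BoundedContinuousFunction in
/-- A Volterra-type equation `h = 1 + ∫ κ h`, solved by contraction in the norm weighted by `exp V`. -/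
theorem exists_volterra_solution {κ : ℝ → ℝ → ℝ} {φ V : ℝ → ℝ} {M : ℝ}
    (hφ : Integrable φ) (hκm : ∀ t, AEStronglyMeasurable (κ t))
    (hκc : ∀ s, Continuous fun t => κ t s) (hκφ : ∀ t s, |κ t s| ≤ |φ s|)
    (hVc : Continuous V) (hV0 : ∀ t, 0 ≤ V t) (hVM : ∀ t, V t ≤ M)
    (hH : ∀ t, ∫ s, |κ t s| * exp (V s) ≤ exp (V t) - 1) :
    ∃ h : ℝ → ℝ, Continuous h ∧ (∀ t, h t = 1 + ∫ s, κ t s * h s) ∧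
      ∀ t, |h t| ≤ exp (V t) := by
  have hexp : ∀ s, exp (V s) ≤ exp M := fun s => exp_le_exp.2 (hVM s)
  have hVneg : ∀ t, exp (-V t) ≤ 1 := fun t => exp_le_one_iff.2 (by linarith [hV0 t])
  have hmul : ∀ t, exp (-V t) * exp (V t) = 1 := fun t => by rw [← exp_add]; simp
  have hdom : ∀ (g : ℝ →ᵇ ℝ) t s, ‖κ t s * (exp (V s) * g s)‖ ≤ |φ s| * (exp M * ‖g‖) := by
    intro g t s
    rw [norm_mul, norm_mul, norm_of_nonneg (exp_pos _).le]
    exact mul_le_mul (hκφ t s) (mul_le_mul (hexp s) (g.norm_coe_le_norm s) (norm_nonneg _)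
      (exp_pos _).le) (by positivity) (abs_nonneg _)
  have hbd : ∀ g : ℝ →ᵇ ℝ, Integrable fun s => |φ s| * (exp M * ‖g‖) :=
    fun g => hφ.abs.mul_const _
  have hmeas : ∀ (g : ℝ →ᵇ ℝ) t, AEStronglyMeasurable fun s => κ t s * (exp (V s) * g s) :=
    fun g t => (hκm t).mul
      ((continuous_exp.comp hVc).mul g.continuous).aestronglyMeasurable
  have hκg : ∀ (g : ℝ →ᵇ ℝ) t, Integrable fun s => κ t s * (exp (V s) * g s) :=
    fun g t => (hbd g).mono' (hmeas g t) (Eventually.of_forall (hdom g t))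
  have habs : ∀ t, Integrable fun s => |κ t s| * exp (V s) := fun t =>
    ((hκg (BoundedContinuousFunction.const ℝ (1 : ℝ)) t).abs).congr (Eventually.of_forall fun s => by
      simp [abs_mul])
  have hkey : ∀ (g : ℝ →ᵇ ℝ) (C : ℝ) (t : ℝ), (∀ s, |g s| ≤ C) →
      |∫ s, κ t s * (exp (V s) * g s)| ≤ (exp (V t) - 1) * C := by
    intro g C t hC
    have hC0 : 0 ≤ C := (abs_nonneg _).trans (hC 0)
    calc |∫ s, κ t s * (exp (V s) * g s)| ≤ ∫ s, |κ t s| * exp (V s) * C := by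
          rw [← Real.norm_eq_abs]
          refine norm_integral_le_of_norm_le ((habs t).mul_const C)
            (Eventually.of_forall fun s => ?_)
          rw [norm_mul, norm_mul, norm_of_nonneg (exp_pos (V s)).le, ← mul_assoc]
          exact mul_le_mul_of_nonneg_left (hC s) (by positivity)
      _ = (∫ s, |κ t s| * exp (V s)) * C := integral_mul_const _ _
      _ ≤ _ := mul_le_mul_of_nonneg_right (hH t) hC0
  have hcont : ∀ g : ℝ →ᵇ ℝ, Continuous fun t => ∫ s, κ t s * (exp (V s) * g s) := fun g =>
    continuous_of_dominated (fun t => hmeas g t)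
      (fun t => Eventually.of_forall (hdom g t)) (hbd g)
      (Eventually.of_forall fun s => (hκc s).mul continuous_const)
  let G : (ℝ →ᵇ ℝ) → (ℝ →ᵇ ℝ) := fun g =>
    BoundedContinuousFunction.ofNormedAddCommGroup
      (fun t => exp (-V t) * (1 + ∫ s, κ t s * (exp (V s) * g s)))
      ((continuous_exp.comp hVc.neg).mul (continuous_const.add (hcont g)))
      (1 + exp M * ‖g‖) (by
        intro t
        rw [norm_mul, norm_of_nonneg (exp_pos _).le]
        have h1 := hkey g ‖g‖ t (fun s => g.norm_coe_le_norm s)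
        have h2 : ‖1 + ∫ s, κ t s * (exp (V s) * g s)‖ ≤ 1 + exp M * ‖g‖ := by
          refine (norm_add_le _ _).trans ?_
          rw [norm_one, Real.norm_eq_abs]
          nlinarith [hexp t, norm_nonneg g]
        have h3 : 0 ≤ 1 + exp M * ‖g‖ := by positivity
        nlinarith [hVneg t, exp_pos (-V t), norm_nonneg (1 + ∫ s, κ t s * (exp (V s) * g s))])
  have hG : ∀ g t, G g t = exp (-V t) * (1 + ∫ s, κ t s * (exp (V s) * g s)) := fun _ _ => rfl
  have hM0 : 0 ≤ M := (hV0 0).trans (hVM 0)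
  have hMle : ∀ t, exp (-M) ≤ exp (-V t) := fun t => exp_le_exp.2 (neg_le_neg (hVM t))
  have hnn : 0 ≤ 1 - exp (-M) := by simpa using hM0
  have hcontr : ContractingWith (1 - exp (-M)).toNNReal G := by
    refine ⟨?_, LipschitzWith.of_dist_le_mul fun g₁ g₂ => ?_⟩
    · rw [← NNReal.coe_lt_coe, Real.coe_toNNReal _ hnn]
      simp [exp_pos]
    · rw [Real.coe_toNNReal _ hnn, BoundedContinuousFunction.dist_le (mul_nonneg hnn dist_nonneg)]
      intro t
      rw [Real.dist_eq, hG, hG, ← mul_sub, add_sub_add_left_eq_sub,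
        ← integral_sub (hκg g₁ t) (hκg g₂ t), abs_mul, abs_of_pos (exp_pos _)]
      have h1 := hkey (g₁ - g₂) (dist g₁ g₂) t (fun s => by
        simpa [Real.dist_eq] using BoundedContinuousFunction.dist_coe_le_dist (f := g₁) (g := g₂) s)
      have h2 : ∫ s, (κ t s * (exp (V s) * g₁ s) - κ t s * (exp (V s) * g₂ s))
          = ∫ s, κ t s * (exp (V s) * (g₁ - g₂) s) := by
        congr 1; ext s; simp; ring
      rw [h2]
      calc exp (-V t) * |∫ s, κ t s * (exp (V s) * (g₁ - g₂) s)|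
          ≤ exp (-V t) * ((exp (V t) - 1) * dist g₁ g₂) :=
            mul_le_mul_of_nonneg_left h1 (exp_pos _).le
        _ = (1 - exp (-V t)) * dist g₁ g₂ := by rw [← mul_assoc, mul_sub, hmul, mul_one]
        _ ≤ (1 - exp (-M)) * dist g₁ g₂ :=
            mul_le_mul_of_nonneg_right (by linarith [hMle t]) dist_nonneg
  set g := hcontr.fixedPoint G
  have hfix : G g = g := hcontr.fixedPoint_isFixedPt
  have hgt : ∀ t, g t = exp (-V t) * (1 + ∫ s, κ t s * (exp (V s) * g s)) := fun t => by
    rw [← hG, hfix]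
  have hnorm : ‖g‖ ≤ 1 := by
    by_contra! hgt1
    have h1 : ‖g‖ ≤ ‖g‖ - (‖g‖ - 1) * exp (-M) := by
      have hM1 : exp (-M) ≤ 1 := by simpa using hM0
      rw [BoundedContinuousFunction.norm_le (by nlinarith [exp_pos (-M)])]
      intro t
      have h2 := hkey g ‖g‖ t (fun s => g.norm_coe_le_norm s)
      rw [hgt, norm_mul, norm_of_nonneg (exp_pos _).le]
      have h3 : ‖1 + ∫ s, κ t s * (exp (V s) * g s)‖ ≤ 1 + (exp (V t) - 1) * ‖g‖ := by
        refine (norm_add_le _ _).trans ?_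
        rw [norm_one, Real.norm_eq_abs]
        linarith
      calc _ ≤ exp (-V t) * (1 + (exp (V t) - 1) * ‖g‖) :=
            mul_le_mul_of_nonneg_left h3 (exp_pos _).le
        _ = ‖g‖ - (‖g‖ - 1) * exp (-V t) := by linear_combination ‖g‖ * hmul t
        _ ≤ _ := by nlinarith [hMle t]
    nlinarith [exp_pos (-M)]
  refine ⟨fun t => exp (V t) * g t, (continuous_exp.comp hVc).mul g.continuous, fun t => ?_,
    fun t => ?_⟩
  · show exp (V t) * g t = _
    rw [hgt t, ← mul_assoc, mul_comm (exp (V t)), hmul, one_mul]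
  · rw [abs_mul, abs_of_pos (exp_pos _)]
    have := (g.norm_coe_le_norm t).trans hnorm
    rw [Real.norm_eq_abs] at this
    nlinarith [exp_pos (V t)]

theorem hasDerivWithinAt_integral_Iic {f : ℝ → ℝ} (hf : ∀ t, IntegrableOn f (Iic t)) {t : ℝ}
    {S S' : Set ℝ} [intervalIntegral.FTCFilter t (nhdsWithin t S) (nhdsWithin t S')]
    (ht : ContinuousWithinAt f S' t) :
    HasDerivWithinAt (fun u => ∫ s in Iic u, f s) (f t) S t := by
  have hii : IntervalIntegrable f volume (t - 1) t :=
    intervalIntegrable_iff.2 ((hf t).mono_set fun s hs => by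
      rw [uIoc_of_le (by linarith)] at hs; exact hs.2)
  have h1 : HasDerivWithinAt (fun u => ∫ s in (t - 1)..u, f s) (f t) S t := by
    refine intervalIntegral.integral_hasDerivWithinAt_right hii (t := S')
      ⟨Iic (t + 1), mem_nhdsWithin_of_mem_nhds (Iic_mem_nhds (by linarith)), ?_⟩ ht
    exact (hf (t + 1)).aestronglyMeasurable
  have h2 : (fun u => ∫ s in Iic u, f s)
      = fun u => (∫ s in Iic (t - 1), f s) + ∫ s in (t - 1)..u, f s := by
    ext u
    simp [← intervalIntegral.integral_Iic_sub_Iic (hf (t - 1)) (hf u)]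
  rw [h2]
  exact h1.const_add _

theorem continuous_integral_Iic {f : ℝ → ℝ} (hf : ∀ t, IntegrableOn f (Iic t)) :
    Continuous fun u => ∫ s in Iic u, f s := by
  have hii : ∀ a b, IntervalIntegrable f volume a b := fun a b =>
    intervalIntegrable_iff.2 ((hf (max a b)).mono_set fun s hs => hs.2)
  have h : (fun u => ∫ s in Iic u, f s) = fun u => (∫ s in Iic 0, f s) + ∫ s in (0:ℝ)..u, f s := by
    ext u
    rw [← intervalIntegral.integral_Iic_sub_Iic (hf 0) (hf u)]
    ring
  rw [h]
  exact continuous_const.add (intervalIntegral.continuous_primitive hii 0)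

theorem setIntegral_Iic_mul_exp_le {w : ℝ → ℝ} (hw : Integrable w) (hw0 : ∀ t, 0 ≤ w t)
    (hwc : ∀ t, ContinuousWithinAt w (Ici t) t) (t : ℝ) :
    IntegrableOn (fun s => w s * exp (∫ r in Iic s, w r)) (Iic t) ∧
    ∫ s in Iic t, w s * exp (∫ r in Iic s, w r) ≤ exp (∫ r in Iic t, w r) - 1 := by
  set V : ℝ → ℝ := fun t => ∫ r in Iic t, w r with hV
  have hVc : Continuous V := continuous_integral_Iic fun t => hw.integrableOn
  have hV0 : ∀ t, 0 ≤ V t := fun t => integral_nonneg hw0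
  have hVM : ∀ t, V t ≤ ∫ r, w r := fun t =>
    setIntegral_le_integral hw (Eventually.of_forall hw0)
  have hκg : Integrable fun s => w s * exp (V s) := by
    refine (hw.mul_const (exp (∫ r, w r))).mono' (hw.aestronglyMeasurable.mul
      (continuous_exp.comp hVc).aestronglyMeasurable) (Eventually.of_forall fun s => ?_)
    rw [norm_mul, norm_of_nonneg (hw0 s), norm_of_nonneg (exp_pos _).le]
    exact mul_le_mul_of_nonneg_left (exp_le_exp.2 (hVM s)) (hw0 s)
  refine ⟨hκg.integrableOn, ?_⟩
  refine le_of_tendsto (intervalIntegral_tendsto_integral_Iic t hκg.integrableOn tendsto_id) ?_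
  refine Eventually.of_forall fun a => ?_
  have hd : ∀ s, HasDerivWithinAt (fun s => exp (V s)) (w s * exp (V s)) (Ici s) s := fun s => by
    have := (hasDerivWithinAt_integral_Iic (S := Ici s) (S' := Ioi s) (fun t => hw.integrableOn)
      ((hwc s).mono Ioi_subset_Ici_self)).exp
    rwa [mul_comm] at this
  have h1 := intervalIntegral.integral_eq_sub_of_hasDeriv_right (a := a) (b := t)
    (continuous_exp.comp hVc).continuousOn (fun s _ => (hd s).mono Ioi_subset_Ici_self)
    hκg.intervalIntegrable
  simp only [id]
  rw [h1]
  have := one_le_exp (hV0 a)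
  simp only [Function.comp]
  linarith

theorem setIntegral_Iic_pos {f : ℝ → ℝ} {s₀ T : ℝ} (hf0 : ∀ s ≤ T, 0 ≤ f s)
    (hf : IntegrableOn f (Iic T)) (hsT : s₀ < T) (hpos : ∀ᶠ s in nhdsWithin s₀ (Ioi s₀), 0 < f s) :
    0 < ∫ s in Iic T, f s := by
  rw [setIntegral_pos_iff_support_of_nonneg_ae
    ((ae_restrict_mem measurableSet_Iic).mono fun s hs => hf0 s hs) hf]
  obtain ⟨u, hu, hsub⟩ := mem_nhdsGT_iff_exists_Ioo_subset.1 hpos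
  have hlt : s₀ < min u T := lt_min hu hsT
  refine lt_of_lt_of_le ?_ (measure_mono (s := Ioo s₀ (min u T)) fun s hs => ⟨?_, ?_⟩)
  · simpa using hlt
  · exact (ne_of_gt (hsub ⟨hs.1, hs.2.trans_le (min_le_left _ _)⟩ : 0 < f s))
  · exact (hs.2.trans_le (min_le_right _ _)).le

/-- Existence, with the Liouville–Green error bound, of a solution of `u' = q v`, `v' = (q + φ) u`
that behaves like `exp ξ` at `-∞`. The last conjunct says that the error bound is uniformly strict
to the right of any point where `φ` does not vanish. -/
theorem exists_liouvilleGreen_solution {q φ ξ V : ℝ → ℝ} (hq : ∀ t, 0 < q t)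
    (hξ : ∀ t, HasDerivAt ξ (q t) t) (hφ : Integrable φ)
    (hφc : ∀ t, ContinuousWithinAt φ (Ici t) t) (hV : ∀ t, V t = ∫ s in Iic t, |φ s| / 2) :
    ∃ u v : ℝ → ℝ, Continuous u ∧ Continuous v ∧
      (∀ t, HasDerivWithinAt u (q t * v t) (Ici t) t) ∧
      (∀ t, HasDerivWithinAt v ((q t + φ t) * u t) (Ici t) t) ∧
      (∀ t, ContinuousAt φ t →
        HasDerivAt u (q t * v t) t ∧ HasDerivAt v ((q t + φ t) * u t) t) ∧
      (∀ t, |u t - exp (ξ t)| ≤ exp (ξ t) * (exp (V t) - 1)) ∧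
      (∀ t, |v t - exp (ξ t)| ≤ 3 * (exp (ξ t) * (exp (V t) - 1))) ∧
      ∀ s₀ T, s₀ < T → φ s₀ ≠ 0 →
        ∃ η > 0, ∀ t ≥ T, |u t - exp (ξ t)| ≤ exp (ξ t) * (exp (V t) - 1 - η) := by
  have hξc : Continuous ξ := continuous_iff_continuousAt.2 fun t => (hξ t).continuousAt
  have hξm : Monotone ξ := monotone_of_hasDerivAt_nonneg hξ fun t => (hq t).le
  set w : ℝ → ℝ := fun s => |φ s| / 2 with hw
  have hwi : Integrable w := hφ.abs.div_const 2
  have hw0 : ∀ t, 0 ≤ w t := fun t => by positivity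
  have hwc : ∀ t, ContinuousWithinAt w (Ici t) t := fun t => (hφc t).abs.div_const 2
  obtain rfl : V = fun t => ∫ s in Iic t, w s := funext hV
  set V : ℝ → ℝ := fun t => ∫ s in Iic t, w s
  have hVc : Continuous V := continuous_integral_Iic fun t => hwi.integrableOn
  have hV0 : ∀ t, 0 ≤ V t := fun t => integral_nonneg hw0
  have hVM : ∀ t, V t ≤ ∫ r, w r := fun t =>
    setIntegral_le_integral hwi (Eventually.of_forall hw0)
  have hwV : ∀ t, IntegrableOn (fun s => w s * exp (V s)) (Iic t) ∧
      ∫ s in Iic t, w s * exp (V s) ≤ exp (V t) - 1 := setIntegral_Iic_mul_exp_le hwi hw0 hwc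
  set κ : ℝ → ℝ → ℝ := fun t s => (1 - exp (-2 * max (ξ t - ξ s) 0)) / 2 * φ s with hκ
  have hκw : ∀ t s, |κ t s| ≤ w s := by
    intro t s
    have h1 : exp (-2 * max (ξ t - ξ s) 0) ≤ 1 :=
      exp_le_one_iff.2 (by linarith [le_max_right (ξ t - ξ s) 0])
    have h2 := exp_pos (-2 * max (ξ t - ξ s) 0)
    simp only [hκ, hw, abs_mul]
    rw [abs_of_nonneg (by linarith)]
    nlinarith [abs_nonneg (φ s)]
  have hκ0 : ∀ t s, s ∉ Iic t → κ t s = 0 := by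
    intro t s hs
    have : ξ t ≤ ξ s := hξm (not_le.1 hs).le
    simp [hκ, max_eq_right (sub_nonpos.2 this)]
  have hκ1 : ∀ t s, s ∈ Iic t → κ t s = (1 - exp (-2 * (ξ t - ξ s))) / 2 * φ s := by
    intro t s hs
    have : ξ s ≤ ξ t := hξm hs
    simp only [hκ]
    rw [max_eq_left (sub_nonneg.2 this)]
  have hκm : ∀ t, AEStronglyMeasurable (κ t) := fun t =>
    (Continuous.aestronglyMeasurable (by fun_prop)).mul hφ.aestronglyMeasurable
  have hκint : ∀ {t} {g : ℝ → ℝ}, Continuous g → (∀ s, |g s| ≤ exp (V s)) →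
      IntegrableOn (fun s => |κ t s| * |g s|) (Iic t) := by
    intro t g hg hgV
    refine (hwV t).1.mono' (((hκm t).norm.mul hg.norm.aestronglyMeasurable).restrict)
      (Eventually.of_forall fun s => ?_)
    rw [norm_mul, norm_of_nonneg (abs_nonneg (κ t s)), norm_of_nonneg (abs_nonneg (g s))]
    exact mul_le_mul (hκw t s) (hgV s) (abs_nonneg _) (hw0 s)
  have hκV : ∀ t, ∫ s, |κ t s| * exp (V s) ≤ exp (V t) - 1 := by
    intro t
    rw [← setIntegral_eq_integral_of_forall_compl_eq_zero (s := Iic t)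
      fun s hs => by rw [hκ0 t s hs]; simp]
    refine (setIntegral_mono_on ?_ (hwV t).1 measurableSet_Iic fun s _ =>
      mul_le_mul_of_nonneg_right (hκw t s) (exp_pos _).le).trans (hwV t).2
    simpa using hκint (t := t) (continuous_exp.comp hVc) (fun s => by simp)
  obtain ⟨h, hhc, hh, hhV⟩ := exists_volterra_solution hφ hκm (fun s => by fun_prop)
    (fun t s => (hκw t s).trans (by simp only [hw]; linarith [abs_nonneg (φ s)])) hVc hV0 hVM hκV
  have hhw : ∀ t, IntegrableOn (fun s => w s * |h s|) (Iic t) := by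
    intro t
    refine (hwV t).1.mono' ((hwi.aestronglyMeasurable.mul
      hhc.norm.aestronglyMeasurable).restrict) (Eventually.of_forall fun s => ?_)
    rw [norm_mul, norm_of_nonneg (hw0 s), norm_of_nonneg (abs_nonneg (h s))]
    exact mul_le_mul_of_nonneg_left (hhV s) (hw0 s)
  have hhκ : ∀ t, |h t - 1| ≤ ∫ s in Iic t, |κ t s| * |h s| := by
    intro t
    rw [hh t, add_sub_cancel_left, ← setIntegral_eq_integral_of_forall_compl_eq_zero (s := Iic t)
      fun s hs => by rw [hκ0 t s hs]; simp]
    refine (abs_integral_le_integral_abs).trans_eq ?_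
    simp only [abs_mul]
  have hh1 : ∀ t, |h t - 1| ≤ ∫ s in Iic t, w s * |h s| := fun t =>
    (hhκ t).trans (setIntegral_mono_on (hκint hhc hhV) (hhw t) measurableSet_Iic
      fun s _ => mul_le_mul_of_nonneg_right (hκw t s) (abs_nonneg _))
  have hbound : ∀ t, ∫ s in Iic t, w s * |h s| ≤ exp (V t) - 1 := fun t =>
    (setIntegral_mono_on (hhw t) (hwV t).1 measurableSet_Iic
      fun s _ => mul_le_mul_of_nonneg_left (hhV s) (hw0 s)).trans (hwV t).2
  set f : ℝ → ℝ := fun s => φ s * h s / 2 with hf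
  have hfa : ∀ s, |f s| = w s * |h s| := fun s => by
    simp only [hf, hw, abs_div, abs_mul, abs_two]; ring
  have hfm : AEStronglyMeasurable f :=
    ((hφ.aestronglyMeasurable.mul hhc.aestronglyMeasurable).mul_const (1 / 2)).congr
      (Eventually.of_forall fun s => by simp only [hf, Pi.mul_apply]; ring)
  have hfi : ∀ t, IntegrableOn f (Iic t) := fun t =>
    (hhw t).mono' hfm.restrict (Eventually.of_forall fun s => (hfa s).le)
  have hgi : ∀ t, IntegrableOn (fun s => exp (2 * ξ s) * f s) (Iic t) := by
    intro t
    refine ((hfi t).abs.const_mul (exp (2 * ξ t))).mono'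
      ((Continuous.aestronglyMeasurable (by fun_prop)).mul hfm).restrict
      ((ae_restrict_mem measurableSet_Iic).mono fun s hs => ?_)
    rw [norm_mul, norm_of_nonneg (exp_pos _).le]
    exact mul_le_mul_of_nonneg_right (exp_le_exp.2 (by linarith [hξm hs])) (abs_nonneg _)
  set F : ℝ → ℝ := fun t => ∫ s in Iic t, f s with hF
  set J : ℝ → ℝ := fun t => ∫ s in Iic t, exp (2 * ξ s) * f s with hJ
  have hFJ : ∀ t, h t = 1 + F t - exp (-2 * ξ t) * J t := by
    intro t
    rw [hh t, ← setIntegral_eq_integral_of_forall_compl_eq_zero (s := Iic t)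
      fun s hs => by rw [hκ0 t s hs]; simp, hF, hJ, add_sub_assoc]
    rw [← integral_const_mul, ← integral_sub (hfi t) ((hgi t).const_mul _)]
    congr 1
    refine setIntegral_congr_fun measurableSet_Iic fun s hs => ?_
    rw [hκ1 t s hs, ← mul_assoc, ← exp_add, show -2 * ξ t + 2 * ξ s = -2 * (ξ t - ξ s) by ring]
    ring
  set u : ℝ → ℝ := fun t => (1 + F t) * exp (ξ t) - J t * exp (-ξ t) with hu
  set v : ℝ → ℝ := fun t => (1 + F t) * exp (ξ t) + J t * exp (-ξ t) with hv
  have hE : ∀ t, exp (-2 * ξ t) * exp (ξ t) = exp (-ξ t) := fun t => by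
    rw [← exp_add]; ring_nf
  have hE2 : ∀ t, exp (2 * ξ t) * exp (-ξ t) = exp (ξ t) := fun t => by
    rw [← exp_add]; ring_nf
  have huh : ∀ t, u t = h t * exp (ξ t) := fun t => by
    simp only [hu, hFJ t, sub_mul]
    linear_combination J t * hE t
  have hFc : Continuous F := continuous_integral_Iic hfi
  have hJc : Continuous J := continuous_integral_Iic hgi
  have hderiv : ∀ t S, HasDerivWithinAt F (f t) S t →
      HasDerivWithinAt J (exp (2 * ξ t) * f t) S t →
      HasDerivWithinAt u (q t * v t) S t ∧ HasDerivWithinAt v ((q t + φ t) * u t) S t := by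
    intro t S hFd hJd
    have h1 := (hFd.const_add 1).mul (hξ t).hasDerivWithinAt.exp
    have h2 := hJd.mul (hξ t).neg.hasDerivWithinAt.exp
    refine ⟨(h1.sub h2).congr_deriv ?_, (h1.add h2).congr_deriv ?_⟩
    · simp only [hv, Pi.neg_apply]
      linear_combination -f t * hE2 t
    · have := huh t
      simp only [Pi.neg_apply]
      rw [add_mul (q t), this]
      have h3 : u t * q t = h t * exp (ξ t) * q t := by rw [this]
      simp only [hu] at h3
      simp only [hf]
      linear_combination φ t * h t / 2 * hE2 t + h3
  have hright := fun t => hderiv t (Ici t)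
    (hasDerivWithinAt_integral_Iic (S' := Ioi t) hfi
      ((((hφc t).mul hhc.continuousWithinAt).div_const 2).mono Ioi_subset_Ici_self))
    (hasDerivWithinAt_integral_Iic (S' := Ioi t) hgi
      (((by fun_prop : ContinuousWithinAt (fun s => exp (2 * ξ s)) (Ici t) t).mul
        (((hφc t).mul hhc.continuousWithinAt).div_const 2)).mono Ioi_subset_Ici_self))
  refine ⟨u, v, by fun_prop, by fun_prop, fun t => (hright t).1, fun t => (hright t).2,
    fun t ht => ?_, fun t => ?_, fun t => ?_, fun s₀ T hsT hs₀ => ?_⟩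
  · have : intervalIntegral.FTCFilter t (nhdsWithin t univ) (nhdsWithin t univ) := by
      rw [nhdsWithin_univ]; infer_instance
    simp only [← hasDerivWithinAt_univ]
    have hft : ContinuousAt f t := (ht.mul hhc.continuousAt).div_const 2
    refine hderiv t univ ?_ ?_
    · exact hasDerivWithinAt_integral_Iic (S' := univ) hfi hft.continuousWithinAt
    · exact hasDerivWithinAt_integral_Iic (S' := univ) hgi
        (((by fun_prop : ContinuousAt (fun s => exp (2 * ξ s)) t).mul hft).continuousWithinAt)
  · rw [huh, show h t * exp (ξ t) - exp (ξ t) = exp (ξ t) * (h t - 1) by ring, abs_mul,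
      abs_of_pos (exp_pos _)]
    exact mul_le_mul_of_nonneg_left ((hh1 t).trans (hbound t)) (exp_pos _).le
  · have h1 : v t - exp (ξ t) = exp (ξ t) * (2 * F t - (h t - 1)) := by
      have h3 : u t = h t * exp (ξ t) := huh t
      simp only [hu] at h3
      simp only [hv]
      linear_combination -h3
    have h2 : |F t| ≤ exp (V t) - 1 :=
      (abs_integral_le_integral_abs.trans_eq (by simp only [hfa])).trans (hbound t)
    have h3 := (hh1 t).trans (hbound t)
    rw [h1, abs_mul, abs_of_pos (exp_pos _), mul_left_comm]
    refine mul_le_mul_of_nonneg_left ?_ (exp_pos _).le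
    rw [abs_le] at h2 h3 ⊢
    constructor <;> linarith
  · have hev : ∀ᶠ s in nhdsWithin s₀ (Ioi s₀), φ s ≠ 0 :=
      ((hφc s₀).mono Ioi_subset_Ici_self).eventually_ne hs₀
    have hstrict : ∀ s > s₀, |h s| < exp (V s) := by
      intro s hs
      have hdiff : 0 < ∫ r in Iic s, (w r * exp (V r) - |κ s r| * |h r|) := by
        refine setIntegral_Iic_pos (fun r _ => sub_nonneg.2 (mul_le_mul (hκw s r) (hhV r)
          (abs_nonneg _) (hw0 r))) ((hwV s).1.sub (hκint hhc hhV)) hs ?_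
        filter_upwards [hev, Ioc_mem_nhdsGT hs] with r hr hrs
        have hlt : |κ s r| < w r := by
          rw [hκ1 s r hrs.2]
          have h1 : exp (-2 * (ξ s - ξ r)) ≤ 1 :=
            exp_le_one_iff.2 (by linarith [hξm hrs.2])
          have h2 := exp_pos (-2 * (ξ s - ξ r))
          simp only [hw, abs_mul]
          rw [abs_of_nonneg (by linarith)]
          nlinarith [abs_pos.2 hr]
        have h1 := mul_le_mul_of_nonneg_left (hhV r) (abs_nonneg (κ s r))
        have h2 := mul_lt_mul_of_pos_right hlt (exp_pos (V r))
        linarith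
      rw [integral_sub (hwV s).1 (hκint hhc hhV)] at hdiff
      have h1 := hhκ s
      have h2 := (hwV s).2
      have h3 : |h s| ≤ |h s - 1| + 1 := by
        simpa using abs_add_le (h s - 1) 1
      linarith
    have hη0 : ∀ s, 0 ≤ w s * exp (V s) - w s * |h s| := fun s =>
      sub_nonneg.2 (mul_le_mul_of_nonneg_left (hhV s) (hw0 s))
    refine ⟨∫ s in Iic T, (w s * exp (V s) - w s * |h s|),
      setIntegral_Iic_pos (fun s _ => hη0 s) ((hwV T).1.sub (hhw T)) hsT ?_, fun t ht => ?_⟩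
    · filter_upwards [hev, self_mem_nhdsWithin] with s hs hss
      have := hstrict s hss
      have hws : 0 < w s := by simp only [hw]; positivity
      nlinarith
    · rw [huh, show h t * exp (ξ t) - exp (ξ t) = exp (ξ t) * (h t - 1) by ring, abs_mul,
        abs_of_pos (exp_pos _)]
      refine mul_le_mul_of_nonneg_left ?_ (exp_pos _).le
      have h1 := setIntegral_mono_set ((hwV t).1.sub (hhw t)) (Eventually.of_forall hη0)
        (LE.le.eventuallyLE (Iic_subset_Iic.2 ht))
      have h2 := integral_sub (hwV t).1 (hhw t)
      have h3 := hh1 t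
      have h4 := (hwV t).2
      simp only [Pi.sub_apply] at h1
      linarith

/-- `(u, v)` solves `u' = q v`, `v' = (q + φ) u` on `[0, ∞)`, in the sense of right derivatives. -/
structure IsPlanarSolution (q φ u v : ℝ → ℝ) : Prop where
  continuousOn_fst : ContinuousOn u (Ici 0)
  continuousOn_snd : ContinuousOn v (Ici 0)
  deriv_fst : ∀ t ≥ 0, HasDerivWithinAt u (q t * v t) (Ici t) t
  deriv_snd : ∀ t ≥ 0, HasDerivWithinAt v ((q t + φ t) * u t) (Ici t) t

namespace IsPlanarSolution

variable {q φ ξ u v u₁ v₁ u₂ v₂ : ℝ → ℝ}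

theorem sub_const_mul (h₁ : IsPlanarSolution q φ u₁ v₁) (h₂ : IsPlanarSolution q φ u₂ v₂) (c : ℝ) :
    IsPlanarSolution q φ (fun t => u₂ t - c * u₁ t) (fun t => v₂ t - c * v₁ t) where
  continuousOn_fst := h₂.1.sub (continuousOn_const.mul h₁.1)
  continuousOn_snd := h₂.2.sub (continuousOn_const.mul h₁.2)
  deriv_fst t ht := ((h₂.3 t ht).sub ((h₁.3 t ht).const_mul c)).congr_deriv (by ring)
  deriv_snd t ht := ((h₂.4 t ht).sub ((h₁.4 t ht).const_mul c)).congr_deriv (by ring)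

theorem wronskian_eq (h₁ : IsPlanarSolution q φ u₁ v₁) (h₂ : IsPlanarSolution q φ u₂ v₂) {t : ℝ}
    (ht : 0 ≤ t) : u₁ t * v₂ t - u₂ t * v₁ t = u₁ 0 * v₂ 0 - u₂ 0 * v₁ 0 := by
  refine constant_of_has_deriv_right_zero (f := fun t => u₁ t * v₂ t - u₂ t * v₁ t)
    (((h₁.1.mul h₂.2).sub (h₂.1.mul h₁.2)).mono Icc_subset_Ici_self) (fun s hs => ?_) t
    (right_mem_Icc.2 ht)
  exact (((h₁.3 s hs.1).mul (h₂.4 s hs.1)).sub ((h₂.3 s hs.1).mul (h₁.4 s hs.1))).congr_deriv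
    (by ring)

theorem sq_add_sq_le (h : IsPlanarSolution q φ u v) (hξ : ∀ t, HasDerivAt ξ (q t) t)
    (hξ0 : ξ 0 = 0) (hq : ∀ t, 0 < q t) (hφ : Continuous φ) {t : ℝ} (ht : 0 ≤ t) :
    u t ^ 2 + v t ^ 2 ≤ (u 0 ^ 2 + v 0 ^ 2) * exp (2 * ξ t + ∫ s in (0:ℝ)..t, |φ s|) := by
  set P : ℝ → ℝ := fun t => ∫ s in (0:ℝ)..t, |φ s|
  have hP : ∀ t, HasDerivAt P |φ t| t := fun t =>
    intervalIntegral.integral_hasDerivAt_right (hφ.abs.intervalIntegrable _ _)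
      (hφ.abs.stronglyMeasurableAtFilter _ _) hφ.abs.continuousAt
  have hE : ∀ t, HasDerivAt (fun t => exp (-(2 * ξ t + P t)))
      (exp (-(2 * ξ t + P t)) * -(2 * q t + |φ t|)) t := fun t =>
    (((hξ t).const_mul 2).add (hP t)).neg.exp
  have key := image_le_of_deriv_right_le_deriv_boundary (a := 0) (b := t)
    (f := fun t => (u t ^ 2 + v t ^ 2) * exp (-(2 * ξ t + P t)))
    (B := fun _ => u 0 ^ 2 + v 0 ^ 2) (B' := fun _ => 0)
    ((((h.1.pow 2).add (h.2.pow 2)).mono Icc_subset_Ici_self).mul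
      (fun t _ => (hE t).continuousAt.continuousWithinAt))
    (fun s hs => (((h.3 s hs.1).pow 2).add ((h.4 s hs.1).pow 2)).mul (hE s).hasDerivWithinAt)
    (by simp [hξ0, P]) continuousOn_const (fun _ _ => hasDerivWithinAt_const _ _ _) (fun s _ => ?_)
    (right_mem_Icc.2 ht)
  · rwa [exp_neg, ← div_eq_mul_inv, div_le_iff₀ (exp_pos _)] at key
  · have h1 : 2 * (u s * v s) * φ s ≤ (u s ^ 2 + v s ^ 2) * |φ s| := by
      have h2 : |2 * (u s * v s)| ≤ u s ^ 2 + v s ^ 2 :=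
        abs_le.2 ⟨by nlinarith [sq_nonneg (u s + v s)], by nlinarith [sq_nonneg (u s - v s)]⟩
      calc _ ≤ |2 * (u s * v s) * φ s| := le_abs_self _
        _ = |2 * (u s * v s)| * |φ s| := abs_mul _ _
        _ ≤ _ := mul_le_mul_of_nonneg_right h2 (abs_nonneg _)
    have h3 : 0 ≤ q s * (u s - v s) ^ 2 := mul_nonneg (hq s).le (sq_nonneg _)
    have h4 := exp_pos (-(2 * ξ s + P s))
    have h5 : 4 * (q s * u s * v s) + 2 * (u s * v s) * φ s
        - (u s ^ 2 + v s ^ 2) * (2 * q s + |φ s|) ≤ 0 := by nlinarith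
    have h6 := mul_nonpos_of_nonneg_of_nonpos h4.le h5
    simp only [Pi.add_apply, Pi.pow_apply, Nat.cast_ofNat, Nat.add_one_sub_one, pow_one]
    linarith

end IsPlanarSolution

theorem exists_growing_solution_s15 {q φ ξ : ℝ → ℝ} (hq : ∀ t, 0 < q t)
    (hξ : ∀ t, HasDerivAt ξ (q t) t) (hξ0 : ξ 0 = 0) (hφ : Continuous φ) (hφi : Integrable φ) :
    ∃ u v : ℝ → ℝ, IsPlanarSolution q φ u v ∧ u 0 = 1 ∧ v 0 = 1 ∧
      (∀ t ≥ 0, |u t - exp (ξ t)| ≤ exp (ξ t) * (exp (1/2 * ∫ s in (0:ℝ)..t, |φ s|) - 1)) ∧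
      ∀ s₀ T, 0 ≤ s₀ → s₀ < T → φ s₀ ≠ 0 → ∃ η > 0, ∀ t ≥ T,
        |u t - exp (ξ t)| ≤ exp (ξ t) * (exp (1/2 * ∫ s in (0:ℝ)..t, |φ s|) - 1 - η) := by
  set φ₁ : ℝ → ℝ := (Ici 0).indicator φ with hφ₁
  have h1 : ∀ t ≥ 0, φ₁ t = φ t := fun t ht => indicator_of_mem (mem_Ici.2 ht) φ
  have hc : ∀ t, ContinuousWithinAt φ₁ (Ici t) t := by
    intro t
    rcases le_or_gt 0 t with ht | ht
    · exact hφ.continuousWithinAt.congr (fun s hs => h1 s (ht.trans hs)) (h1 t ht)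
    · have : φ₁ =ᶠ[nhds t] fun _ => 0 := by
        filter_upwards [Iio_mem_nhds ht] with s hs
        exact indicator_of_notMem (not_le.2 hs) φ
      exact (continuousAt_const.congr this.symm).continuousWithinAt
  have hV : ∀ t ≥ 0, ∫ s in Iic t, |φ₁ s| / 2 = 1/2 * ∫ s in (0:ℝ)..t, |φ s| := by
    intro t ht
    rw [integral_div, intervalIntegral.integral_of_le ht, ← integral_Icc_eq_integral_Ioc]
    have h2 : ∀ s, |φ₁ s| = (Ici 0).indicator (fun s => |φ s|) s := fun s => by
      by_cases hs : s ∈ Ici (0:ℝ) <;> simp [hφ₁, hs]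
    simp only [h2]
    rw [setIntegral_indicator measurableSet_Ici, Iic_inter_Ici]
    ring
  obtain ⟨u, v, huc, hvc, hu, hv, -, hub, hvb, hsl⟩ := exists_liouvilleGreen_solution
    (φ := φ₁) hq hξ (hφi.indicator measurableSet_Ici) hc (fun t => rfl)
  have hV0 : ∫ s in Iic 0, |φ₁ s| / 2 = 0 := by simp [hV 0 le_rfl]
  refine ⟨u, v, ⟨huc.continuousOn, hvc.continuousOn, fun t _ => hu t, fun t ht => ?_⟩, ?_, ?_,
    fun t ht => ?_, fun s₀ T hs₀ hsT hne => ?_⟩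
  · simpa [h1 t ht] using hv t
  · have := hub 0
    rw [hV0] at this
    simpa [hξ0, sub_eq_zero] using this
  · have := hvb 0
    rw [hV0] at this
    simpa [hξ0, sub_eq_zero] using this
  · simpa only [hV t ht] using hub t
  · obtain ⟨η, hη, h⟩ := hsl s₀ T hsT (by rwa [h1 s₀ hs₀])
    exact ⟨η, hη, fun t ht => by
      simpa only [hV t (hs₀.trans (hsT.le.trans ht))] using h t ht⟩

theorem exists_decaying_solution_s15 {q φ ξ : ℝ → ℝ} (hq : ∀ t, 0 < q t)
    (hξ : ∀ t, HasDerivAt ξ (q t) t) (hφ : Continuous φ) (hφi : Integrable φ) :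
    ∃ u v : ℝ → ℝ, IsPlanarSolution q φ u v ∧
      (∀ t, |u t - exp (-ξ t)| ≤ exp (-ξ t) * (exp (1/2 * ∫ s in Ioi t, |φ s|) - 1)) ∧
      ∀ s₀ T, T < s₀ → φ s₀ ≠ 0 → ∃ η > 0, ∀ t ≤ T,
        |u t - exp (-ξ t)| ≤ exp (-ξ t) * (exp (1/2 * ∫ s in Ioi t, |φ s|) - 1 - η) := by
  have hV : ∀ t, 1/2 * ∫ s in Ioi t, |φ s| = ∫ s in Iic (-t), |φ (-s)| / 2 := by
    intro t
    rw [integral_div, integral_comp_neg_Iic (-t) (fun s => |φ s|), neg_neg]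
    ring
  have hneg : ∀ t : ℝ, HasDerivAt (fun s : ℝ => -s) (-1) t := fun t => (hasDerivAt_id t).neg
  have hξ' : ∀ t, HasDerivAt (fun t => -ξ (-t)) (q (-t)) t := fun t =>
    ((hξ (-t)).comp t (hneg t)).neg.congr_deriv (by ring)
  obtain ⟨u, v, huc, hvc, -, -, hd, hub, -, hsl⟩ := exists_liouvilleGreen_solution
    (φ := fun t => φ (-t)) (fun t => hq (-t)) hξ' hφi.comp_neg
    (fun t => (hφ.comp continuous_neg).continuousWithinAt) (fun t => rfl)
  have hd' := fun t => hd (-t) (hφ.comp continuous_neg).continuousAt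
  refine ⟨fun t => u (-t), fun t => -v (-t), ⟨by fun_prop, by fun_prop, fun t _ => ?_,
    fun t _ => ?_⟩, fun t => ?_, fun s₀ T hsT hne => ?_⟩
  · exact (((hd' t).1.comp t (hneg t)).congr_deriv (by simp)).hasDerivWithinAt
  · exact (((hd' t).2.comp t (hneg t)).neg.congr_deriv (by simp)).hasDerivWithinAt
  · simpa only [hV t, neg_neg] using hub (-t)
  · obtain ⟨η, hη, h⟩ := hsl (-s₀) (-T) (neg_lt_neg hsT) (by rwa [neg_neg])
    exact ⟨η, hη, fun t ht => by
      simpa only [hV t, neg_neg] using h (-t) (neg_le_neg ht)⟩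

theorem exists_eq_add_of_abs_le {D X Y a b : ℝ} (ha : 0 ≤ a) (hb : 0 ≤ b)
    (h : |D| ≤ |X| * a + |Y| * b) : ∃ c d : ℝ, |c| ≤ a ∧ |d| ≤ b ∧ D = X * c + Y * d := by
  set R := |X| * a + |Y| * b with hR
  have hR0 : 0 ≤ R := by positivity
  rcases hR0.eq_or_lt with h0 | h0
  · exact ⟨0, 0, by simpa, by simpa, by simpa using abs_nonpos_iff.1 (h.trans h0.ge)⟩
  · have hθ : |D / R| ≤ 1 := by
      rw [abs_div, abs_of_pos h0]
      exact div_le_one_of_le₀ h hR0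
    have hs : ∀ z : ℝ, |(SignType.sign z : ℝ)| ≤ 1 := fun z => by
      rcases lt_trichotomy z 0 with hz | rfl | hz
      · simp [sign_neg hz]
      · simp
      · simp [sign_pos hz]
    have hle : ∀ z e : ℝ, 0 ≤ e → |D / R * e * SignType.sign z| ≤ e := fun z e he => by
      rw [abs_mul, abs_mul, abs_of_nonneg he]
      calc |D / R| * e * |(SignType.sign z : ℝ)| ≤ 1 * e * 1 := by gcongr; exact hs z
        _ = e := by ring
    refine ⟨D / R * a * SignType.sign X, D / R * b * SignType.sign Y, hle X a ha, hle Y b hb, ?_⟩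
    have hX : X * SignType.sign X = |X| := self_mul_sign X
    have hY : Y * SignType.sign Y = |Y| := self_mul_sign Y
    calc D = D / R * R := by field_simp
      _ = _ := by rw [hR, ← hX, ← hY]; ring

theorem abs_integral_le_and_tendsto {φ : ℝ → ℝ} (hφi : Integrable φ) :
    (∀ t ≥ 0, ∫ s in (0:ℝ)..t, |φ s| ≤ ∫ s, |φ s|) ∧
      Tendsto (fun t => ∫ s in Ioi t, |φ s|) atTop (nhds 0) := by
  refine ⟨fun t ht => ?_, ?_⟩
  · rw [intervalIntegral.integral_of_le ht]
    exact setIntegral_le_integral hφi.abs (ae_of_all _ fun _ => abs_nonneg _)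
  · have h := intervalIntegral_tendsto_integral_Ioi (0:ℝ) hφi.abs.integrableOn tendsto_id
    have h' := h.const_sub (∫ s in Ioi (0:ℝ), |φ s|)
    rw [sub_self] at h'
    refine h'.congr fun t => ?_
    rw [id, ← intervalIntegral.integral_Ioi_sub_Ioi' hφi.abs.integrableOn hφi.abs.integrableOn]
    ring

theorem IsPlanarSolution.exists_liouvilleGreen {q φ ξ u v : ℝ → ℝ} (hq : ∀ t, 0 < q t)
    (hξ : ∀ t, HasDerivAt ξ (q t) t) (hξ0 : ξ 0 = 0) (hφ : Continuous φ) (hφi : Integrable φ)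
    (h : IsPlanarSolution q φ u v) :
    ∃ A B : ℝ, ∀ t ≥ 0, |u t - A * exp (ξ t) - B * exp (-ξ t)| ≤
      |A * exp (ξ t)| * (exp (1/2 * ∫ s in (0:ℝ)..t, |φ s|) - 1) +
      |B * exp (-ξ t)| * (exp (1/2 * ∫ s in Ioi t, |φ s|) - 1) := by
  obtain ⟨u₁, v₁, h₁, hu₁, hv₁, hb₁, hs₁⟩ := exists_growing_solution_s15 hq hξ hξ0 hφ hφi
  obtain ⟨u₂, v₂, h₂, hb₂, hs₂⟩ := exists_decaying_solution_s15 hq hξ hφ hφi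
  obtain ⟨hPle, hlim⟩ := abs_integral_le_and_tendsto hφi
  have hξm : StrictMono ξ := strictMono_of_hasDerivAt_pos hξ hq
  have split : ∀ A B t : ℝ, |u t - A * exp (ξ t) - B * exp (-ξ t)| ≤
      |u t - A * u₁ t - B * u₂ t| + |A| * |u₁ t - exp (ξ t)| + |B| * |u₂ t - exp (-ξ t)| := by
    intro A B t
    rw [← abs_mul, ← abs_mul]
    refine le_trans (le_of_eq ?_) (abs_add_three _ _ _)
    congr 1
    ring
  have hexp : ∀ A t : ℝ, |A * exp t| = |A| * exp t := fun A t => by rw [abs_mul, abs_exp]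
  simp only [hexp]
  by_cases hW : u₁ 0 * v₂ 0 - u₂ 0 * v₁ 0 = 0
  swap
  · refine ⟨(u 0 * v₂ 0 - u₂ 0 * v 0) / (u₁ 0 * v₂ 0 - u₂ 0 * v₁ 0),
      (u₁ 0 * v 0 - u 0 * v₁ 0) / (u₁ 0 * v₂ 0 - u₂ 0 * v₁ 0), fun t ht => ?_⟩
    refine (split _ _ t).trans ?_
    have h0 : u t - (u 0 * v₂ 0 - u₂ 0 * v 0) / (u₁ 0 * v₂ 0 - u₂ 0 * v₁ 0) * u₁ t -
        (u₁ 0 * v 0 - u 0 * v₁ 0) / (u₁ 0 * v₂ 0 - u₂ 0 * v₁ 0) * u₂ t = 0 := by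
      have hw := h₁.wronskian_eq h₂ ht
      rw [← h.wronskian_eq h₂ ht, ← h₁.wronskian_eq h ht]
      generalize u₁ 0 * v₂ 0 - u₂ 0 * v₁ 0 = W at hW hw
      field_simp
      rw [← hw]
      ring
    rw [h0, abs_zero, zero_add, mul_assoc, mul_assoc]
    gcongr
    exacts [hb₁ t ht, hb₂ t]
  set c := u₂ 0 with hc
  rw [hu₁, hv₁, one_mul, mul_one, sub_eq_zero] at hW
  have hprop : ∀ t ≥ 0, u₂ t = c * u₁ t := by
    intro t ht
    have := (h₁.sub_const_mul h₂ c).sq_add_sq_le hξ hξ0 hq hφ ht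
    rw [hu₁, hv₁, hW, ← hc] at this
    simp only [mul_one, sub_self, ne_eq, OfNat.ofNat_ne_zero, not_false_eq_true, zero_pow,
      add_zero, zero_mul] at this
    nlinarith [sq_nonneg (u₂ t - c * u₁ t), sq_nonneg (v₂ t - c * v₁ t)]
  have hc0 : c ≠ 0 := by
    intro h0
    have hlim' : Tendsto (fun t => exp (1/2 * ∫ s in Ioi t, |φ s|) - 1) atTop (nhds 0) := by
      simpa only [mul_zero, exp_zero, sub_self] using ((hlim.const_mul (1/2)).rexp).sub_const 1
    obtain ⟨t, ht, ht0⟩ := ((hlim'.eventually (gt_mem_nhds one_pos)).and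
      (eventually_ge_atTop 0)).exists
    have := hb₂ t
    rw [hprop t ht0, h0, zero_mul, zero_sub, abs_neg, abs_exp] at this
    nlinarith [exp_pos (-ξ t)]
  obtain ⟨s₀, hs₀, hφs₀⟩ : ∃ s > 0, φ s ≠ 0 := by
    by_contra! hz
    have hz1 : ∫ s in (0:ℝ)..1, |φ s| = 0 := by
      rw [intervalIntegral.integral_of_le zero_le_one]
      refine setIntegral_eq_zero_of_forall_eq_zero fun s hs => ?_
      rw [hz s hs.1, abs_zero]
    have hz2 : ∀ t ≥ 0, ∫ s in Ioi t, |φ s| = 0 := fun t ht =>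
      setIntegral_eq_zero_of_forall_eq_zero fun s hs => by
        rw [hz s (lt_of_le_of_lt ht hs), abs_zero]
    have e1 := hb₁ 1 zero_le_one
    have e2 := hb₂ 1
    have e3 := hb₂ 0
    rw [hz1] at e1
    rw [hz2 1 zero_le_one] at e2
    rw [hz2 0 le_rfl, hξ0, ← hc] at e3
    simp only [mul_zero, exp_zero, sub_self, neg_zero, abs_nonpos_iff, sub_eq_zero] at e1 e2 e3
    have := hprop 1 zero_le_one
    rw [e1, e2, e3, one_mul, exp_eq_exp] at this
    have := hξm one_pos
    linarith
  obtain ⟨d, hd, hball⟩ : ∃ d > 0, ∀ s, |s - s₀| < d → φ s ≠ 0 := by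
    obtain ⟨d, hd, h⟩ := Metric.eventually_nhds_iff.1 (hφ.continuousAt.eventually_ne hφs₀)
    exact ⟨d, hd, fun s hs => h hs⟩
  obtain ⟨η₁, hη₁, k₁⟩ := hs₁ s₀ (s₀ + d / 4) hs₀.le (by linarith) hφs₀
  obtain ⟨η₂, hη₂, k₂⟩ := hs₂ (s₀ + d / 2) (s₀ + d / 4) (by linarith)
    (hball _ (by rw [add_sub_cancel_left, abs_of_pos (by linarith)]; linarith))
  set T := s₀ + d / 4
  obtain ⟨C, hC0, hC⟩ : ∃ C ≥ 0, ∀ t ≥ 0, |u t| ≤ C * exp (ξ t) := by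
    set I := ∫ s, |φ s|
    refine ⟨√((u 0 ^ 2 + v 0 ^ 2) * exp I), sqrt_nonneg _, fun t ht => ?_⟩
    refine abs_le_of_sq_le_sq ?_ (by positivity)
    rw [mul_pow, sq_sqrt (by positivity), ← exp_nat_mul, mul_assoc, ← exp_add]
    calc u t ^ 2 ≤ u t ^ 2 + v t ^ 2 := le_add_of_nonneg_right (sq_nonneg _)
      _ ≤ _ := h.sq_add_sq_le hξ hξ0 hq hφ ht
      _ ≤ _ := by
        refine mul_le_mul_of_nonneg_left (exp_le_exp.2 ?_) (by positivity)
        push_cast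
        linarith [hPle t ht]
  set K := max (C / η₁) (C * exp (2 * ξ T) * |c| / η₂) with hK
  have hK0 : 0 ≤ K := le_max_of_le_left (by positivity)
  refine ⟨K, -(K / c), fun t ht => (split _ _ t).trans ?_⟩
  have h0 : u t - K * u₁ t - -(K / c) * u₂ t = u t := by
    rw [hprop t ht]
    field_simp
    ring
  rw [h0]
  rcases le_total T t with hT | hT
  · have e1 : |u t| ≤ |K| * exp (ξ t) * η₁ := by
      rw [abs_of_nonneg hK0]
      have := (div_le_iff₀ hη₁).1 (le_max_left (C / η₁) (C * exp (2 * ξ T) * |c| / η₂))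
      nlinarith [hC t ht, exp_pos (ξ t)]
    have e2 := mul_le_mul_of_nonneg_left (k₁ t hT) (abs_nonneg K)
    have e3 := mul_le_mul_of_nonneg_left (hb₂ t) (abs_nonneg (-(K / c)))
    linarith
  · have e1 : |u t| ≤ |-(K / c)| * exp (-ξ t) * η₂ := by
      rw [abs_neg, abs_div, abs_of_nonneg hK0]
      have h1 := le_max_right (C / η₁) (C * exp (2 * ξ T) * |c| / η₂)
      rw [← hK, div_le_iff₀ hη₂, ← le_div_iff₀ (abs_pos.2 hc0)] at h1
      have h2 : exp (ξ t) ≤ exp (2 * ξ T) * exp (-ξ t) := by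
        rw [← exp_add]
        exact exp_le_exp.2 (by linarith [hξm.monotone hT])
      calc |u t| ≤ C * exp (ξ t) := hC t ht
        _ ≤ C * (exp (2 * ξ T) * exp (-ξ t)) := by gcongr
        _ = C * exp (2 * ξ T) * exp (-ξ t) := by ring
        _ ≤ K * η₂ / |c| * exp (-ξ t) := by gcongr
        _ = _ := by ring
    have e2 := mul_le_mul_of_nonneg_left (hb₁ t ht) (abs_nonneg K)
    have e3 := mul_le_mul_of_nonneg_left (k₂ t hT) (abs_nonneg (-(K / c)))
    linarith

/-- `f` is continuous and bounded on `[0, ∞)`. -/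
def ContBddOn (f : ℝ → ℝ) : Prop :=
  ContinuousOn f (Ici 0) ∧ ∃ C, ∀ t ≥ 0, |f t| ≤ C

namespace ContBddOn

variable {f g : ℝ → ℝ}

theorem const (c : ℝ) : ContBddOn fun _ => c := ⟨continuousOn_const, |c|, fun _ _ => le_rfl⟩

theorem add (hf : ContBddOn f) (hg : ContBddOn g) : ContBddOn fun t => f t + g t := by
  obtain ⟨hf, C, hC⟩ := hf
  obtain ⟨hg, D, hD⟩ := hg
  exact ⟨hf.add hg, C + D, fun t ht => (abs_add_le _ _).trans (add_le_add (hC t ht) (hD t ht))⟩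

theorem mul (hf : ContBddOn f) (hg : ContBddOn g) : ContBddOn fun t => f t * g t := by
  obtain ⟨hf, C, hC⟩ := hf
  obtain ⟨hg, D, hD⟩ := hg
  refine ⟨hf.mul hg, C * D, fun t ht => ?_⟩
  rw [abs_mul]
  exact mul_le_mul (hC t ht) (hD t ht) (abs_nonneg _) ((abs_nonneg _).trans (hC t ht))

theorem sub (hf : ContBddOn f) (hg : ContBddOn g) : ContBddOn fun t => f t - g t := by
  simpa only [neg_one_mul, sub_eq_add_neg] using hf.add ((const (-1)).mul hg)

theorem mul_integrableOn (hf : ContBddOn f) (hg : IntegrableOn g (Ici 0)) :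
    IntegrableOn (fun t => f t * g t) (Ici 0) := by
  obtain ⟨hf, C, hC⟩ := hf
  exact Integrable.bdd_mul hg (hf.aestronglyMeasurable measurableSet_Ici)
    (ae_restrict_of_forall_mem measurableSet_Ici hC)

theorem of_hasDerivAt (hf : ∀ t, HasDerivAt f (g t) t) (hg : Continuous g)
    (hgi : IntegrableOn g (Ici 0)) : ContBddOn f := by
  refine ⟨fun t _ => (hf t).continuousAt.continuousWithinAt,
    |f 0| + ∫ s in Ici (0:ℝ), |g s|, fun t ht => ?_⟩
  have h1 : f t = f 0 + ∫ s in (0:ℝ)..t, g s := by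
    rw [intervalIntegral.integral_eq_sub_of_hasDerivAt (fun s _ => hf s) (hg.intervalIntegrable _ _)]
    ring
  rw [h1]
  refine (abs_add_le _ _).trans (by
    gcongr
    refine (intervalIntegral.abs_integral_le_integral_abs ht).trans ?_
    rw [intervalIntegral.integral_of_le ht]
    exact setIntegral_mono_set hgi.abs (ae_of_all _ fun _ => abs_nonneg _)
      (Ioc_subset_Ioi_self.trans Ioi_subset_Ici_self).eventuallyLE)

end ContBddOn

section

variable {a a₁ a₂ a₃ e e₁ e₂ e₃ G G₁ G₂ : ℝ → ℝ} {l b : ℝ}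

theorem exists_pos_le_discriminant (hl : 0 < l) (hb : 0 < b) (ha : ∀ t ≥ 0, b ≤ a t)
    (he : ∀ t ≥ 0, 0 < e t) (he0 : ∀ t ≥ 0, e t ≤ e 0) (he₁ : ∀ t ≥ 0, e₁ t ≤ 0)
    (hsmall : ∀ t ≥ 0, e 0 * (2 * |a₁ t| + 4 * l) < b ^ 2) (hlim : Tendsto e atTop (nhds 0))
    (ha₁ : ContBddOn a₁) (hGc : ContinuousOn G (Ici 0))
    (hG : ∀ t, G t = a t ^ 2 / 4 + (a₁ t * e t - a t * e₁ t) / 2 - l * e t) :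
    ∃ c > 0, ∀ t ≥ 0, c ≤ G t := by
  have key : ∀ t ≥ 0, b ^ 2 - e t * (2 * |a₁ t| + 4 * l) ≤ 4 * G t := by
    intro t ht
    rw [hG]
    have h1 : b ^ 2 ≤ a t ^ 2 := pow_le_pow_left₀ hb.le (ha t ht) 2
    have h2 : 0 ≤ a t * (-e₁ t) := mul_nonneg (hb.le.trans (ha t ht)) (neg_nonneg.2 (he₁ t ht))
    have h3 : e t * -a₁ t ≤ e t * |a₁ t| :=
      mul_le_mul_of_nonneg_left (neg_le_abs _) (he t ht).le
    linarith
  have hpos : ∀ t ≥ 0, 0 < G t := by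
    intro t ht
    have h1 : e t * (2 * |a₁ t| + 4 * l) ≤ e 0 * (2 * |a₁ t| + 4 * l) :=
      mul_le_mul_of_nonneg_right (he0 t ht) (by positivity)
    linarith [key t ht, hsmall t ht]
  obtain ⟨-, M, hM⟩ := ha₁
  have hM0 : 0 ≤ M := (abs_nonneg _).trans (hM 0 le_rfl)
  have hlim' : Tendsto (fun t => e t * (2 * M + 4 * l)) atTop (nhds 0) := by
    simpa using hlim.mul_const (2 * M + 4 * l)
  obtain ⟨T, hT⟩ := eventually_atTop.1
    (hlim'.eventually (gt_mem_nhds (show 0 < b ^ 2 / 2 by positivity)))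
  obtain ⟨t₀, ht₀, hmin⟩ := (isCompact_Icc (a := (0:ℝ)) (b := max T 0)).exists_isMinOn
    ⟨0, left_mem_Icc.2 (le_max_right _ _)⟩ (hGc.mono Icc_subset_Ici_self)
  refine ⟨min (G t₀) (b ^ 2 / 8), lt_min (hpos t₀ ht₀.1) (by positivity), fun t ht => ?_⟩
  rcases le_total t (max T 0) with h | h
  · exact min_le_of_left_le (hmin ⟨ht, h⟩)
  · refine min_le_of_right_le ?_
    have h1 : e t * (2 * |a₁ t| + 4 * l) ≤ e t * (2 * M + 4 * l) :=
      mul_le_mul_of_nonneg_left (by linarith [hM t ht]) (he t ht).le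
    linarith [key t ht, hT t ((le_max_left _ _).trans h)]

theorem integrableOn_liouvilleGreen_error (he : ∀ t ≥ 0, 0 < e t)
    (ha : ContBddOn a) (ha₁ : ContBddOn a₁) (ha₂ : ContBddOn a₂)
    (hee : ContBddOn e) (he₁ : ContBddOn e₁) (he₂ : ContBddOn e₂)
    (hia₁ : IntegrableOn a₁ (Ici 0)) (hia₂ : IntegrableOn a₂ (Ici 0))
    (hia₃ : IntegrableOn a₃ (Ici 0)) (hie₁ : IntegrableOn e₁ (Ici 0))
    (hie₂ : IntegrableOn e₂ (Ici 0)) (hie₃ : IntegrableOn e₃ (Ici 0))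
    (hsq : IntegrableOn (fun t => e₁ t ^ 2 / e t) (Ici 0))
    (hG : ∀ t, G t = a t ^ 2 / 4 + (a₁ t * e t - a t * e₁ t) / 2 - l * e t)
    (hG₁ : ∀ t, G₁ t = a t * a₁ t / 2 + (a₂ t * e t - a t * e₂ t) / 2 - l * e₁ t)
    (hG₂ : ∀ t, G₂ t = (a₁ t ^ 2 + a t * a₂ t) / 2 +
      (a₃ t * e t + a₂ t * e₁ t - a₁ t * e₂ t - a t * e₃ t) / 2 - l * e₂ t)
    {c : ℝ} (hc : 0 < c) (hcG : ∀ t ≥ 0, c ≤ G t) :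
    IntegrableOn (fun t => (4 * (G t / e t ^ 2) * (G₂ t / e t ^ 2 - 4 * G₁ t * e₁ t / e t ^ 3 -
        2 * G t * e₂ t / e t ^ 3 + 6 * G t * e₁ t ^ 2 / e t ^ 4) -
      5 * (G₁ t / e t ^ 2 - 2 * G t * e₁ t / e t ^ 3) ^ 2) /
      (16 * (G t / e t ^ 2) ^ ((5:ℝ)/2))) (Ici 0) := by
  have bG : ContBddOn G := by
    have := (((ContBddOn.const (1/4)).mul (ha.mul ha)).add ((ContBddOn.const (1/2)).mul
      ((ha₁.mul hee).sub (ha.mul he₁)))).sub ((ContBddOn.const l).mul hee)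
    refine (funext fun t => ?_ : _ = G) ▸ this
    rw [hG]; ring
  have bG₁ : ContBddOn G₁ := by
    have := (((ContBddOn.const (1/2)).mul (ha.mul ha₁)).add ((ContBddOn.const (1/2)).mul
      ((ha₂.mul hee).sub (ha.mul he₂)))).sub ((ContBddOn.const l).mul he₁)
    refine (funext fun t => ?_ : _ = G₁) ▸ this
    rw [hG₁]; ring
  have iG₁ : IntegrableOn G₁ (Ici 0) := by
    have := (((ContBddOn.const (1/2)).mul_integrableOn (ha.mul_integrableOn hia₁)).add
      ((ContBddOn.const (1/2)).mul_integrableOn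
      ((hee.mul_integrableOn hia₂).sub (ha.mul_integrableOn hie₂)))).sub
      ((ContBddOn.const l).mul_integrableOn hie₁)
    refine this.congr (ae_of_all _ fun t => ?_)
    simp only [Pi.add_apply, Pi.sub_apply, hG₁]; ring
  have iG₂ : IntegrableOn G₂ (Ici 0) := by
    have := (((ContBddOn.const (1/2)).mul_integrableOn
      ((ha₁.mul_integrableOn hia₁).add (ha.mul_integrableOn hia₂))).add
      ((ContBddOn.const (1/2)).mul_integrableOn
      ((((hee.mul_integrableOn hia₃).add (ha₂.mul_integrableOn hie₁)).sub
        (ha₁.mul_integrableOn hie₂)).sub (ha.mul_integrableOn hie₃)))).sub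
      ((ContBddOn.const l).mul_integrableOn hie₂)
    refine this.congr (ae_of_all _ fun t => ?_)
    simp only [Pi.add_apply, Pi.sub_apply, hG₂]; ring
  have bR : ContBddOn fun t => (G t ^ ((5:ℝ)/2))⁻¹ := by
    refine ⟨(bG.1.rpow_const fun t ht => .inr (by norm_num)).inv₀ fun t ht =>
      (rpow_pos_of_pos (hc.trans_le (hcG t ht)) _).ne', (c ^ ((5:ℝ)/2))⁻¹, fun t ht => ?_⟩
    have h0 := rpow_pos_of_pos hc (5/2)
    have h1 := rpow_le_rpow hc.le (hcG t ht) (show (0:ℝ) ≤ 5/2 by norm_num)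
    rw [abs_inv, abs_of_pos (h0.trans_le h1)]
    exact inv_anti₀ h0 h1
  have main := ((ContBddOn.const (1/16)).mul bR).mul_integrableOn
    ((((((ContBddOn.const 4).mul (bG.mul hee)).mul_integrableOn iG₂).add
      (((ContBddOn.const 4).mul (bG.mul bG₁)).mul_integrableOn hie₁)).add
      (((ContBddOn.const 4).mul (bG.mul bG)).mul_integrableOn hsq)).sub
      (((ContBddOn.const 8).mul (bG.mul bG)).mul_integrableOn hie₂) |>.sub
      (((ContBddOn.const 5).mul (bG₁.mul hee)).mul_integrableOn iG₁))
  refine main.congr (ae_restrict_of_forall_mem measurableSet_Ici fun t ht => ?_)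
  have het := he t ht
  have hGt := hc.trans_le (hcG t ht)
  have hpow : (G t / e t ^ 2) ^ ((5:ℝ)/2) = G t ^ ((5:ℝ)/2) / e t ^ 5 := by
    rw [div_rpow hGt.le (by positivity), ← rpow_natCast, ← rpow_natCast, ← rpow_mul het.le]
    norm_num
  have hR := rpow_pos_of_pos hGt (5/2)
  simp only [Pi.add_apply, Pi.sub_apply]
  rw [hpow]
  generalize G t ^ ((5:ℝ)/2) = R at hR ⊢
  field_simp
  ring

end

theorem isPlanarSolution_of_ode {s s₁ s₂ p p₁ P κ x x₁ x₂ q φ : ℝ → ℝ}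
    (hs : ∀ t ≥ 0, 0 < s t) (hs₁ : ∀ t ≥ 0, HasDerivAt s (s₁ t) t)
    (hs₂ : ∀ t ≥ 0, HasDerivAt s₁ (s₂ t) t) (hp₁ : ∀ t ≥ 0, HasDerivAt p (p₁ t) t)
    (hP : ∀ t ≥ 0, HasDerivAt P (p t / 2) t) (hx₁ : ∀ t ≥ 0, HasDerivAt x (x₁ t) t)
    (hx₂ : ∀ t ≥ 0, HasDerivAt x₁ (x₂ t) t)
    (hode : ∀ t ≥ 0, x₂ t = -p t * x₁ t - κ t * x t)
    (hr : ∀ t ≥ 0, s t ^ 4 = p t ^ 2 / 4 + p₁ t / 2 - κ t)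
    (hq : ∀ t ≥ 0, q t = s t ^ 2) (hφ : ∀ t ≥ 0, φ t = s₂ t / s t ^ 3 - 2 * s₁ t ^ 2 / s t ^ 4) :
    IsPlanarSolution q φ (fun t => s t * exp (P t) * x t)
      (fun t => exp (P t) * ((s₁ t + s t * p t / 2) * x t + s t * x₁ t) / s t ^ 2) := by
  have hu : ∀ t ≥ 0, HasDerivAt (fun t => s t * exp (P t) * x t)
      (q t * (exp (P t) * ((s₁ t + s t * p t / 2) * x t + s t * x₁ t) / s t ^ 2)) t := by
    intro t ht
    have := (hs t ht).ne'
    refine (((hs₁ t ht).mul (hP t ht).exp).mul (hx₁ t ht)).congr_deriv ?_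
    rw [hq t ht]
    simp only [Pi.mul_apply]
    field_simp
  have hv : ∀ t ≥ 0, HasDerivAt
      (fun t => exp (P t) * ((s₁ t + s t * p t / 2) * x t + s t * x₁ t) / s t ^ 2)
      ((q t + φ t) * (s t * exp (P t) * x t)) t := by
    intro t ht
    have hst := (hs t ht).ne'
    refine (((hP t ht).exp.mul ((((hs₂ t ht).add (((hs₁ t ht).mul (hp₁ t ht)).div_const 2)).mul
      (hx₁ t ht)).add ((hs₁ t ht).mul (hx₂ t ht)))).div ((hs₁ t ht).pow 2)
      (pow_ne_zero 2 hst)).congr_deriv ?_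
    have hp : p₁ t = 2 * (s t ^ 4 - p t ^ 2 / 4 + κ t) := by linarith [hr t ht]
    rw [hq t ht, hφ t ht, hode t ht, hp]
    simp only [Pi.mul_apply, Pi.add_apply, Pi.pow_apply]
    field_simp
    ring
  exact ⟨fun t ht => (hu t ht).continuousAt.continuousWithinAt,
    fun t ht => (hv t ht).continuousAt.continuousWithinAt,
    fun t ht => (hu t ht).hasDerivWithinAt, fun t ht => (hv t ht).hasDerivWithinAt⟩

/-- The Liouville–Green representation for a potential given on `[0, ∞)` only. -/
theorem IsPlanarSolution.exists_liouvilleGreen_Ici {q φ u v : ℝ → ℝ} (hq : ∀ t ≥ 0, 0 < q t)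
    (hqc : ContinuousOn q (Ici 0)) (hφ : ContinuousOn φ (Ici 0)) (hφi : IntegrableOn φ (Ici 0))
    (h : IsPlanarSolution q φ u v) :
    ∃ A B : ℝ, ∃ δ₁ δ₂ : ℝ → ℝ,
      (∀ t ≥ 0, |δ₁ t| ≤ exp (1/2 * ∫ s in (0:ℝ)..t, |φ s|) - 1 ∧
        |δ₂ t| ≤ exp (1/2 * ∫ s in Ioi t, |φ s|) - 1) ∧
      ∀ t ≥ 0, u t = A * (1 + δ₁ t) * exp (∫ s in (0:ℝ)..t, q s) +
        B * (1 + δ₂ t) * exp (-∫ s in (0:ℝ)..t, q s) := by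
  have hmax : ∀ t : ℝ, max t 0 ∈ Ici (0:ℝ) := fun t => le_max_right t 0
  have hmaxc : Continuous fun t : ℝ => max t 0 := by fun_prop
  set q' : ℝ → ℝ := fun t => q (max t 0) with hq'
  set φ' : ℝ → ℝ := fun t => φ (max t 0) * exp (min t 0) with hφ'
  have hqq : ∀ t ≥ 0, q' t = q t := fun t ht => by simp only [hq', max_eq_left ht]
  have hφφ : ∀ t ≥ 0, φ' t = φ t := fun t ht => by
    simp only [hφ', max_eq_left ht, min_eq_right ht, exp_zero, mul_one]
  have hq'c : Continuous q' := hqc.comp_continuous hmaxc hmax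
  have hφ'c : Continuous φ' := (hφ.comp_continuous hmaxc hmax).mul (by fun_prop)
  have hφ'i : Integrable φ' := by
    rw [← integrableOn_univ, ← Iic_union_Ici (a := (0:ℝ))]
    refine IntegrableOn.union ?_ (hφi.congr_fun (fun t ht => (hφφ t ht).symm) measurableSet_Ici)
    refine IntegrableOn.congr_fun ((integrableOn_exp_Iic 0).const_mul (φ 0)) (fun t ht => ?_)
      measurableSet_Iic
    simp only [hφ', max_eq_right (mem_Iic.1 ht), min_eq_left (mem_Iic.1 ht)]
  have h' : IsPlanarSolution q' φ' u v := ⟨h.1, h.2,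
    fun t ht => by rw [hqq t ht]; exact h.3 t ht,
    fun t ht => by rw [hqq t ht, hφφ t ht]; exact h.4 t ht⟩
  obtain ⟨A, B, hAB⟩ := h'.exists_liouvilleGreen (ξ := fun t => ∫ s in (0:ℝ)..t, q' s)
    (fun t => hq _ (hmax t)) (fun t => intervalIntegral.integral_hasDerivAt_right
      (hq'c.intervalIntegrable _ _) (hq'c.stronglyMeasurableAtFilter _ _) hq'c.continuousAt)
    intervalIntegral.integral_same hφ'c hφ'i
  have key : ∀ t, ∃ d₁ d₂ : ℝ, t ≥ 0 → (|d₁| ≤ exp (1/2 * ∫ s in (0:ℝ)..t, |φ s|) - 1 ∧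
      |d₂| ≤ exp (1/2 * ∫ s in Ioi t, |φ s|) - 1) ∧
      u t = A * (1 + d₁) * exp (∫ s in (0:ℝ)..t, q s) +
        B * (1 + d₂) * exp (-∫ s in (0:ℝ)..t, q s) := by
    intro t
    by_cases ht : 0 ≤ t
    swap
    · exact ⟨0, 0, fun h => absurd h ht⟩
    have e1 : ∫ s in (0:ℝ)..t, q' s = ∫ s in (0:ℝ)..t, q s :=
      intervalIntegral.integral_congr fun s hs => hqq s (by rw [uIcc_of_le ht] at hs; exact hs.1)
    have e2 : ∫ s in (0:ℝ)..t, |φ' s| = ∫ s in (0:ℝ)..t, |φ s| :=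
      intervalIntegral.integral_congr fun s hs => by
        rw [uIcc_of_le ht] at hs
        simp only [hφφ s hs.1]
    have e3 : ∫ s in Ioi t, |φ' s| = ∫ s in Ioi t, |φ s| :=
      setIntegral_congr_fun measurableSet_Ioi fun s hs => by
        simp only [hφφ s (ht.trans (le_of_lt hs))]
    have hb := hAB t ht
    simp only [e1, e2, e3] at hb
    have nn : ∀ z : ℝ, 0 ≤ z → 0 ≤ exp (1/2 * z) - 1 := fun z hz =>
      sub_nonneg.2 (one_le_exp (by positivity))
    obtain ⟨d₁, d₂, h1, h2, h3⟩ := exists_eq_add_of_abs_le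
      (nn _ (intervalIntegral.integral_nonneg ht fun _ _ => abs_nonneg _))
      (nn _ (integral_nonneg fun _ => abs_nonneg _)) hb
    exact ⟨d₁, d₂, fun _ => ⟨⟨h1, h2⟩, by linear_combination h3⟩⟩
  choose δ₁ δ₂ hδ using key
  exact ⟨A, B, δ₁, δ₂, fun t ht => (hδ t ht).1, fun t ht => (hδ t ht).2⟩

theorem exists_liouvilleGreen_of_ode {p p₁ κ r r₁ r₂ φ x x₁ x₂ : ℝ → ℝ}
    (hp₁ : ∀ t ≥ 0, HasDerivAt p (p₁ t) t) (hr : ∀ t ≥ 0, r t = p t ^ 2 / 4 + p₁ t / 2 - κ t)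
    (hr0 : ∀ t ≥ 0, 0 < r t) (hr₁ : ∀ t ≥ 0, HasDerivAt r (r₁ t) t)
    (hr₂ : ∀ t ≥ 0, HasDerivAt r₁ (r₂ t) t) (hr₂c : ContinuousOn r₂ (Ici 0))
    (hφ : ∀ t ≥ 0, φ t = (4 * r t * r₂ t - 5 * r₁ t ^ 2) / (16 * r t ^ ((5:ℝ)/2)))
    (hφi : IntegrableOn φ (Ici 0)) (hx₁ : ∀ t ≥ 0, HasDerivAt x (x₁ t) t)
    (hx₂ : ∀ t ≥ 0, HasDerivAt x₁ (x₂ t) t)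
    (hode : ∀ t ≥ 0, x₂ t = -p t * x₁ t - κ t * x t) :
    ∃ A B : ℝ, ∃ δ₁ δ₂ : ℝ → ℝ,
      (∀ t ≥ 0, |δ₁ t| ≤ exp (1/2 * ∫ s in (0:ℝ)..t, |φ s|) - 1 ∧
        |δ₂ t| ≤ exp (1/2 * ∫ s in Ioi t, |φ s|) - 1) ∧
      ∀ t ≥ 0, x t =
        A * ((1 + δ₁ t) / r t ^ ((1:ℝ)/4)) * exp (∫ s in (0:ℝ)..t, -p s / 2 + √(r s)) +
        B * ((1 + δ₂ t) / r t ^ ((1:ℝ)/4)) * exp (∫ s in (0:ℝ)..t, -p s / 2 - √(r s)) := by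
  have hpc : ContinuousOn p (Ici 0) := fun t ht => (hp₁ t ht).continuousAt.continuousWithinAt
  have hrc : ContinuousOn r (Ici 0) := fun t ht => (hr₁ t ht).continuousAt.continuousWithinAt
  have hr₁c : ContinuousOn r₁ (Ici 0) := fun t ht => (hr₂ t ht).continuousAt.continuousWithinAt
  have hp'c : Continuous fun t => p (max t 0) / 2 :=
    (hpc.comp_continuous (by fun_prop) fun t => le_max_right t 0).div_const 2
  have hP : ∀ t ≥ 0, HasDerivAt (fun t => ∫ s in (0:ℝ)..t, p (max s 0) / 2) (p t / 2) t := by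
    intro t ht
    have := intervalIntegral.integral_hasDerivAt_right (hp'c.intervalIntegrable 0 t)
      (hp'c.stronglyMeasurableAtFilter _ _) hp'c.continuousAt
    rwa [max_eq_left ht] at this
  have hpow : ∀ t ≥ 0, ∀ (c : ℝ) (n : ℕ), c = 1 / 4 * n → r t ^ c = (r t ^ ((1:ℝ)/4)) ^ n := by
    rintro t ht c n rfl
    rw [rpow_mul (hr0 t ht).le, rpow_natCast]
  have hinv : ∀ t ≥ 0, ∀ (c : ℝ) (n : ℕ), c = -(1 / 4 * n) →
      r t ^ c = ((r t ^ ((1:ℝ)/4)) ^ n)⁻¹ := by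
    rintro t ht c n rfl
    rw [rpow_neg (hr0 t ht).le, hpow t ht _ n rfl]
  have hone : ∀ t ≥ 0, r t = (r t ^ ((1:ℝ)/4)) ^ 4 := fun t ht => by
    rw [← hpow t ht 1 4 (by norm_num), rpow_one]
  have hsqrt : ∀ t ≥ 0, √(r t) = (r t ^ ((1:ℝ)/4)) ^ 2 := fun t ht => by
    rw [sqrt_eq_rpow, hpow t ht _ 2 (by norm_num)]
  have hs0 : ∀ t ≥ 0, 0 < r t ^ ((1:ℝ)/4) := fun t ht => rpow_pos_of_pos (hr0 t ht) _
  have hsol := isPlanarSolution_of_ode (s := fun t => r t ^ ((1:ℝ)/4))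
    (s₁ := fun t => r₁ t * (1/4) * r t ^ (-(3/4) : ℝ))
    (s₂ := fun t => r₂ t * (1/4) * r t ^ (-(3/4) : ℝ) +
      r₁ t * (1/4) * (r₁ t * (-(3/4)) * r t ^ (-(7/4) : ℝ)))
    (q := fun t => √(r t)) (φ := φ) hs0
    (fun t ht => ((hr₁ t ht).rpow_const (.inl (hr0 t ht).ne')).congr_deriv (by norm_num))
    (fun t ht => (((hr₂ t ht).mul_const (1/4)).mul
      ((hr₁ t ht).rpow_const (.inl (hr0 t ht).ne'))).congr_deriv (by norm_num))
    hp₁ hP hx₁ hx₂ hode (fun t ht => by rw [← hone t ht, hr t ht]) hsqrt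
    (fun t ht => by
      have h0 := hs0 t ht
      rw [hφ t ht]
      simp only [hinv t ht (-(3/4)) 3 (by norm_num), hinv t ht (-(7/4)) 7 (by norm_num),
        hpow t ht (5/2) 10 (by norm_num)]
      have h1 := hone t ht
      generalize r t ^ ((1:ℝ)/4) = y at h0 h1 ⊢
      rw [h1]
      field_simp
      ring)
  obtain ⟨A, B, δ₁, δ₂, hδ, h⟩ := hsol.exists_liouvilleGreen_Ici
    (fun t ht => sqrt_pos.2 (hr0 t ht)) hrc.sqrt
    (((((continuousOn_const.mul hrc).mul hr₂c).sub (continuousOn_const.mul (hr₁c.pow 2))).div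
      (continuousOn_const.mul (hrc.rpow_const fun t ht => .inl (hr0 t ht).ne'))
      (fun t ht => (mul_pos (by norm_num) (rpow_pos_of_pos (hr0 t ht) _)).ne')).congr hφ) hφi
  refine ⟨A, B, δ₁, δ₂, hδ, fun t ht => ?_⟩
  have hsub : uIcc 0 t ⊆ Ici 0 := by
    rw [uIcc_of_le ht]
    exact Icc_subset_Ici_self
  have hPt : ∫ s in (0:ℝ)..t, -p s / 2 = -∫ s in (0:ℝ)..t, p (max s 0) / 2 := by
    rw [← intervalIntegral.integral_neg]
    refine intervalIntegral.integral_congr fun s hs => ?_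
    simp only [max_eq_left (mem_Ici.1 (hsub hs)), neg_div]
  have hip : IntervalIntegrable (fun s => -p s / 2) volume 0 t :=
    ((hpc.mono hsub).neg.div_const 2).intervalIntegrable
  have hiq : IntervalIntegrable (fun s => √(r s)) volume 0 t :=
    (hrc.mono hsub).sqrt.intervalIntegrable
  rw [intervalIntegral.integral_add hip hiq, intervalIntegral.integral_sub hip hiq, hPt,
    sub_eq_add_neg, exp_add, exp_add]
  have hu := h t ht
  have h0 := (hs0 t ht).ne'
  rw [exp_neg (∫ s in (0:ℝ)..t, p (max s 0) / 2)]
  have hE := exp_pos (∫ s in (0:ℝ)..t, p (max s 0) / 2)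
  field_simp
  linarith

theorem ContDiff.hasDerivAt_deriv_of_three {f : ℝ → ℝ} (hf : ContDiff ℝ 3 f) :
    (∀ t, HasDerivAt f (deriv f t) t) ∧ (∀ t, HasDerivAt (deriv f) (deriv (deriv f) t) t) ∧
      (∀ t, HasDerivAt (deriv (deriv f)) (deriv (deriv (deriv f)) t) t) ∧
      Continuous (deriv (deriv (deriv f))) := by
  have h1 : ContDiff ℝ 2 (deriv f) := hf.deriv'
  have h2 : ContDiff ℝ 1 (deriv (deriv f)) := h1.deriv'
  exact ⟨fun t => (hf.differentiable (by norm_num) t).hasDerivAt,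
    fun t => (h1.differentiable (by norm_num) t).hasDerivAt,
    fun t => (h2.differentiable (by norm_num) t).hasDerivAt, h2.continuous_deriv le_rfl⟩

theorem stmt15
    (lam β : ℝ) (hlam : 0 < lam) (hβ : 0 < β)
    (ε α : ℝ → ℝ)
    (hε_anti : AntitoneOn ε (Set.Ici 0)) (hε_pos : ∀ t ∈ Set.Ici (0:ℝ), 0 < ε t)
    (hα_anti : AntitoneOn α (Set.Ici 0)) (hα_nonneg : ∀ t ∈ Set.Ici (0:ℝ), 0 ≤ α t)
    (hε3 : ContDiff ℝ 3 ε) (hα3 : ContDiff ℝ 3 α)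
    (hsmall : ∀ t ∈ Set.Ici (0:ℝ), ε 0 < (β * lam) ^ 2 / (2 * |deriv α t| + 4 * lam))
    (hε1 : MeasureTheory.IntegrableOn (deriv ε) (Set.Ici 0))
    (hε2 : MeasureTheory.IntegrableOn (deriv (deriv ε)) (Set.Ici 0))
    (hε3' : MeasureTheory.IntegrableOn (deriv (deriv (deriv ε))) (Set.Ici 0))
    (hα1 : MeasureTheory.IntegrableOn (deriv α) (Set.Ici 0))
    (hα2 : MeasureTheory.IntegrableOn (deriv (deriv α)) (Set.Ici 0))
    (hα3' : MeasureTheory.IntegrableOn (deriv (deriv (deriv α))) (Set.Ici 0))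
    (hεlim : Filter.Tendsto ε Filter.atTop (nhds 0))
    (hεsq : MeasureTheory.IntegrableOn (fun t => deriv ε t ^ 2 / ε t) (Set.Ici 0))
    (x : ℝ → ℝ) (x0 v0 : ℝ) (hx : ContDiff ℝ 2 x)
    (hx0 : x 0 = x0) (hv0 : deriv x 0 = v0)
    (hode : ∀ t ∈ Set.Ici (0:ℝ),
      ε t * deriv (deriv x) t + (α t + β * lam) * deriv x t + lam * x t = 0)
    (p r φ : ℝ → ℝ)
    (hp : ∀ t, p t = (α t + β * lam) / ε t)
    (hr : ∀ t, r t = p t ^ 2 / 4 + deriv p t / 2 - lam / ε t)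
    (hφ : ∀ t, φ t
      = (4 * r t * deriv (deriv r) t - 5 * deriv r t ^ 2) / (16 * r t ^ ((5:ℝ)/2))) :
    ∃ A B : ℝ, ∃ δ1 δ2 : ℝ → ℝ,
      (∀ t ∈ Set.Ici (0:ℝ),
        |δ1 t| ≤ Real.exp (1/2 * ∫ s in (0:ℝ)..t, |φ s|) - 1 ∧
        |δ2 t| ≤ Real.exp (1/2 * ∫ s in Set.Ioi t, |φ s|) - 1) ∧
      ∀ t ∈ Set.Ici (0:ℝ),
        x t = A * ((1 + δ1 t) / r t ^ ((1:ℝ)/4))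
                * Real.exp (∫ s in (0:ℝ)..t, -p s / 2 + Real.sqrt (r s))
            + B * ((1 + δ2 t) / r t ^ ((1:ℝ)/4))
                * Real.exp (∫ s in (0:ℝ)..t, -p s / 2 - Real.sqrt (r s)) := by
  obtain ⟨de, de₁, de₂, ce₃⟩ := hε3.hasDerivAt_deriv_of_three
  obtain ⟨dα, da₁, da₂, ca₃⟩ := hα3.hasDerivAt_deriv_of_three
  have ce₂ : Continuous (deriv (deriv ε)) :=
    continuous_iff_continuousAt.2 fun t => (de₂ t).continuousAt
  have ce₁ : Continuous (deriv ε) := continuous_iff_continuousAt.2 fun t => (de₁ t).continuousAt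
  have ca₂ : Continuous (deriv (deriv α)) :=
    continuous_iff_continuousAt.2 fun t => (da₂ t).continuousAt
  have ca₁ : Continuous (deriv α) := continuous_iff_continuousAt.2 fun t => (da₁ t).continuousAt
  have ce : Continuous ε := hε3.continuous
  set e₁ := deriv ε
  set e₂ := deriv e₁
  set e₃ := deriv e₂
  set a₁ := deriv α
  set a₂ := deriv a₁
  set a₃ := deriv a₂
  obtain ⟨a, ha⟩ : ∃ a : ℝ → ℝ, ∀ t, a t = α t + β * lam := ⟨_, fun _ => rfl⟩
  have da : ∀ t, HasDerivAt a (a₁ t) t := fun t => by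
    rw [funext ha]
    exact (dα t).add_const _
  have ca : Continuous a := continuous_iff_continuousAt.2 fun t => (da t).continuousAt
  simp only [← ha] at hp hode
  obtain ⟨G, hG⟩ : ∃ G : ℝ → ℝ, ∀ t,
      G t = a t ^ 2 / 4 + (a₁ t * ε t - a t * e₁ t) / 2 - lam * ε t := ⟨_, fun _ => rfl⟩
  obtain ⟨G₁, hG₁⟩ : ∃ G₁ : ℝ → ℝ, ∀ t,
      G₁ t = a t * a₁ t / 2 + (a₂ t * ε t - a t * e₂ t) / 2 - lam * e₁ t := ⟨_, fun _ => rfl⟩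
  obtain ⟨G₂, hG₂⟩ : ∃ G₂ : ℝ → ℝ, ∀ t, G₂ t = (a₁ t ^ 2 + a t * a₂ t) / 2 +
      (a₃ t * ε t + a₂ t * e₁ t - a₁ t * e₂ t - a t * e₃ t) / 2 - lam * e₂ t := ⟨_, fun _ => rfl⟩
  have cG : Continuous G := by rw [funext hG]; fun_prop
  have cG₁ : Continuous G₁ := by rw [funext hG₁]; fun_prop
  have cG₂ : Continuous G₂ := by rw [funext hG₂]; fun_prop
  have dG : ∀ t, HasDerivAt G (G₁ t) t := fun t => by
    rw [funext hG]
    refine (((((da t).pow 2).div_const 4).add ((((da₁ t).mul (de t)).sub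
      ((da t).mul (de₁ t))).div_const 2)).sub ((de t).const_mul lam)).congr_deriv ?_
    rw [hG₁]
    push_cast
    ring
  have dG₁ : ∀ t, HasDerivAt G₁ (G₂ t) t := fun t => by
    rw [funext hG₁]
    refine (((((da t).mul (da₁ t)).div_const 2).add ((((da₂ t).mul (de t)).sub
      ((da t).mul (de₂ t))).div_const 2)).sub ((de₁ t).const_mul lam)).congr_deriv ?_
    rw [hG₂]
    ring
  have dp : ∀ t, 0 < ε t → HasDerivAt p (a₁ t / ε t - a t * e₁ t / ε t ^ 2) t := fun t ht => by
    rw [funext hp]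
    refine ((da t).div (de t) ht.ne').congr_deriv ?_
    field_simp
  have hrG : ∀ t, 0 < ε t → r t = G t / ε t ^ 2 := fun t ht => by
    rw [hr, (dp t ht).deriv, hp, hG]
    field_simp
  have hnhds : ∀ t, 0 < ε t → ∀ᶠ s in nhds t, 0 < ε s := fun t ht =>
    ce.continuousAt.eventually (lt_mem_nhds ht)
  obtain ⟨r₁, hr₁⟩ : ∃ r₁ : ℝ → ℝ, ∀ t, r₁ t = G₁ t / ε t ^ 2 - 2 * G t * e₁ t / ε t ^ 3 :=
    ⟨_, fun _ => rfl⟩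
  obtain ⟨r₂, hr₂⟩ : ∃ r₂ : ℝ → ℝ, ∀ t, r₂ t = G₂ t / ε t ^ 2 - 4 * G₁ t * e₁ t / ε t ^ 3 -
      2 * G t * e₂ t / ε t ^ 3 + 6 * G t * e₁ t ^ 2 / ε t ^ 4 := ⟨_, fun _ => rfl⟩
  have dr : ∀ t, 0 < ε t → HasDerivAt r (r₁ t) t := fun t ht => by
    refine HasDerivAt.congr_of_eventuallyEq ?_ ((hnhds t ht).mono hrG)
    refine ((dG t).div ((de t).pow 2) (pow_ne_zero 2 ht.ne')).congr_deriv ?_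
    rw [hr₁]
    simp only [Pi.pow_apply]
    field_simp
    push_cast
    ring
  have dr₁ : ∀ t, 0 < ε t → HasDerivAt r₁ (r₂ t) t := fun t ht => by
    rw [funext hr₁]
    refine (((dG₁ t).div ((de t).pow 2) (pow_ne_zero 2 ht.ne')).sub
      ((((dG t).const_mul 2).mul (de₁ t)).div ((de t).pow 3)
        (pow_ne_zero 3 ht.ne'))).congr_deriv ?_
    rw [hr₂]
    simp only [Pi.pow_apply, Pi.mul_apply]
    field_simp
    push_cast
    ring
  have dr₂ : ∀ t, 0 < ε t → deriv (deriv r) t = r₂ t := fun t ht => by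
    have h : deriv r =ᶠ[nhds t] r₁ := (hnhds t ht).mono fun s hs => (dr s hs).deriv
    rw [h.deriv_eq, (dr₁ t ht).deriv]
  have hb : 0 < β * lam := mul_pos hβ hlam
  have be : ContBddOn ε := .of_hasDerivAt de ce₁ hε1
  have be₁ : ContBddOn e₁ := .of_hasDerivAt de₁ ce₂ hε2
  have be₂ : ContBddOn e₂ := .of_hasDerivAt de₂ ce₃ hε3'
  have ba : ContBddOn a := .of_hasDerivAt da ca₁ hα1
  have ba₁ : ContBddOn a₁ := .of_hasDerivAt da₁ ca₂ hα2
  have ba₂ : ContBddOn a₂ := .of_hasDerivAt da₂ ca₃ hα3'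
  obtain ⟨c, hc, hcG⟩ := exists_pos_le_discriminant hlam hb
    (fun t ht => by rw [ha]; linarith [hα_nonneg t ht]) hε_pos
    (fun t ht => hε_anti self_mem_Ici ht ht)
    (fun t ht => by
      rw [← (de t).hasDerivWithinAt.derivWithin (uniqueDiffOn_Ici 0 t ht)]
      exact hε_anti.derivWithin_nonpos)
    (fun t ht => (lt_div_iff₀ (by positivity)).1 (hsmall t ht)) hεlim ba₁ cG.continuousOn hG
  have hφi : IntegrableOn φ (Ici 0) :=
    (integrableOn_liouvilleGreen_error hε_pos ba ba₁ ba₂ be be₁ be₂ hα1 hα2 hα3' hε1 hε2 hε3'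
      hεsq hG hG₁ hG₂ hc hcG).congr_fun (fun t ht => by
        simp only [hφ t, dr₂ t (hε_pos t ht), (dr t (hε_pos t ht)).deriv, hr₁, hr₂,
          hrG t (hε_pos t ht)]) measurableSet_Ici
  have hx' : ContDiff ℝ 1 (deriv x) := hx.deriv'
  refine exists_liouvilleGreen_of_ode (κ := fun t => lam / ε t) (r₂ := r₂)
    (fun t ht => dp t (hε_pos t ht))
    (fun t ht => by rw [hr, (dp t (hε_pos t ht)).deriv])
    (fun t ht => by
      have h1 := hε_pos t ht
      have h2 := hc.trans_le (hcG t ht)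
      rw [hrG t h1]
      positivity)
    (fun t ht => dr t (hε_pos t ht)) (fun t ht => dr₁ t (hε_pos t ht)) ?_
    (fun t ht => by rw [hφ, dr₂ t (hε_pos t ht), (dr t (hε_pos t ht)).deriv]) hφi
    (fun t _ => (hx.differentiable (by norm_num) t).hasDerivAt)
    (fun t _ => (hx'.differentiable (by norm_num) t).hasDerivAt) (fun t ht => ?_)
  · rw [funext hr₂]
    have hne : ∀ n : ℕ, ∀ t ∈ Ici (0:ℝ), ε t ^ n ≠ 0 := fun n t ht =>
      pow_ne_zero n (hε_pos t ht).ne'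
    exact (((cG₂.continuousOn.div (ce.pow 2).continuousOn (hne 2)).sub
      (((continuous_const.mul cG₁).mul ce₁).continuousOn.div (ce.pow 3).continuousOn (hne 3))).sub
      (((continuous_const.mul cG).mul ce₂).continuousOn.div (ce.pow 3).continuousOn (hne 3))).add
      (((continuous_const.mul cG).mul (ce₁.pow 2)).continuousOn.div (ce.pow 4).continuousOn (hne 4))
  · have h1 := hε_pos t ht
    have h2 := hode t ht
    simp only [hp]
    field_simp
    linarith
end
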